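/- Suppose that for some i ∈ {1,…,h−1} and j ∈ {1,…,k−1} one has b_{i+1} ≥ d_j − t_j + 2 and a_i ≤ c_{j+1} + t_{j+1} − 2. Let X_1 = (x_{v,u}), 1 ≤ v ≤ d_j, 1 ≤ u ≤ a_i, and let X_2 = (y_{v,u}), b_{i+1} ≤ v ≤ m, c_{j+1} ≤ u ≤ n, be matrices of indeterminates with disjoint sets of variables. Let L_1 ⊆ X_1 be the ladder with lower outside corners (d_1,c_1),…,(d_j,c_j) and upper outside corners (b_1,a_1),…,(b_i,a_i), and let L_2 ⊆ X_2 be the ladder with lower outside corners (d_{j+1},c_{j+1}),…,(d_k,c_k) and upper outside corners (b_{i+1},a_{i+1}),…,(b_h,a_h). Set σ = (t_1,…,t_j), τ = (t_{j+1},…,t_k), R_σ(L_1) = K[L_1]/I_σ(L_1), R_τ(L_2) = K[L_2]/I_τ(L_2), and R_t(L) = K[L]/I_t(L). Then R_t(L) ≅ (R_σ(L_1) ⊗_K R_τ(L_2))/I, where I is the ideal generated by the (d_j − b_{i+1} + 1)(a_i − c_{j+1} + 1) linear forms x_{v,u} − y_{v,u} for b_{i+1} ≤ v ≤ d_j and c_{j+1}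 ≤ u ≤ a_i; moreover ht I = (d_j − b_{i+1} + 1)(a_i − c_{j+1} + 1) and these linear forms form a regular sequence in R_σ(L_1) ⊗_K R_τ(L_2). -/

import Mathlib

open MvPolynomial

/-- The data of a two-sided ladder inside an `m × n` matrix of indeterminates,
with upper outside corners `(b i, a i)` and lower outside corners `(d j, c j)`,
together with a vector `t` of minor sizes, subject to the standing assumptions. -/
structure LadderData where
  m : ℕ
  n : ℕ
  h : ℕ
  k : ℕ
  hpos : 0 < h
  kpos : 0 < k
  hmn : m ≤ n
  b : Fin h → ℕ
  a : Fin h → ℕ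
  d : Fin k → ℕ
  c : Fin k → ℕ
  t : Fin k → ℕ
  b_mono : StrictMono b
  a_mono : StrictMono a
  b_first : b ⟨0, hpos⟩ = 1
  b_le : ∀ i, b i ≤ m
  a_pos : ∀ i, 1 ≤ a i
  a_last : a ⟨h - 1, Nat.sub_lt hpos Nat.one_pos⟩ = n
  d_mono : Monotone d
  c_mono : Monotone c
  d_pos : ∀ j, 1 ≤ d j
  d_last : d ⟨k - 1, Nat.sub_lt kpos Nat.one_pos⟩ = m
  c_first : c ⟨0, kpos⟩ = 1
  c_le : ∀ j, c j ≤ n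
  corners_distinct : ∀ j j' : Fin k, d j = d j' → c j = c j' → j = j'
  t_pos : ∀ j, 1 ≤ t j
  step_d : ∀ (j : ℕ) (hj : j + 1 < k),
    d ⟨j, Nat.lt_of_succ_lt hj⟩ + t ⟨j + 1, hj⟩ < d ⟨j + 1, hj⟩ + t ⟨j, Nat.lt_of_succ_lt hj⟩
  step_c : ∀ (j : ℕ) (hj : j + 1 < k),
    c ⟨j, Nat.lt_of_succ_lt hj⟩ + t ⟨j, Nat.lt_of_succ_lt hj⟩ < c ⟨j + 1, hj⟩ + t ⟨j + 1, hj⟩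

namespace LadderData

/-- The set of positions (row, column) of the indeterminates of the ladder `L`. -/
def L (D : LadderData) : Set (ℕ × ℕ) :=
  {p | ∃ (i : Fin D.h) (j : Fin D.k),
    D.b i ≤ p.1 ∧ p.1 ≤ D.m ∧ 1 ≤ p.2 ∧ p.2 ≤ D.a i ∧
    1 ≤ p.1 ∧ p.1 ≤ D.d j ∧ D.c j ≤ p.2 ∧ p.2 ≤ D.n}

/-- The one-sided subladder `L_j` with lower outside corner `(d j, c j)`. -/
def Lj (D : LadderData) (j : Fin D.k) : Set (ℕ × ℕ) :=
  {p ∈ D.L | p.1 ≤ D.d j ∧ D.c j ≤ p.2}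

end LadderData

/-- The ideal of `K[V]` (`V` a set of positions of indeterminates) generated by the
`s × s` minors of the generic matrix all of whose entries lie in `S`. -/
noncomputable def minorsIdeal (K : Type*) [Field K] (V S : Set (ℕ × ℕ)) (s : ℕ) :
    Ideal (MvPolynomial ↥V K) :=
  Ideal.span {f | ∃ r cc : Fin s → ℕ, StrictMono r ∧ StrictMono cc ∧
    (∀ p q, (r p, cc q) ∈ S) ∧
    ∃ hmem : ∀ p q, ((r p, cc q) : ℕ × ℕ) ∈ V,
    f = (Matrix.of fun p q =>
      (MvPolynomial.X (⟨(r p, cc q), hmem p q⟩ : V) : MvPolynomial ↥V K)).det}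

/-- The mixed ladder determinantal ideal `I_t(L) = I_{t_1}(L_1) + ⋯ + I_{t_k}(L_k) ⊆ K[L]`. -/
noncomputable def LadderData.It (D : LadderData) (K : Type*) [Field K] :
    Ideal (MvPolynomial ↥D.L K) :=
  ⨆ j : Fin D.k, minorsIdeal K D.L (D.Lj j) (D.t j)

/-- Every entry of the ladder is involved in one of the minors generating `I_t(L)`. -/
def LadderData.Nondeg (D : LadderData) : Prop :=
  ∀ p ∈ D.L, ∃ (j : Fin D.k) (r cc : Fin (D.t j) → ℕ),
    StrictMono r ∧ StrictMono cc ∧ (∀ u v, (r u, cc v) ∈ D.Lj j) ∧ ∃ u v, (r u, cc v) = p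

/-- The height of an ideal: the infimum of the heights of the prime ideals containing it. -/
noncomputable def idealHeight {R : Type*} [CommRing R] (I : Ideal R) : ℕ∞ :=
  ⨅ (P : PrimeSpectrum R) (_ : I ≤ P.asIdeal), Order.height P

section PolynomialRing

variable {K : Type*} [Field K] {σ : Type*}

theorem mem_span_X_image_of_X_mul_mem {s : Set σ} {j : σ} (hj : j ∉ s) {f : MvPolynomial σ K}
    (h : X j * f ∈ Ideal.span (X '' s : Set (MvPolynomial σ K))) :
    f ∈ Ideal.span (X '' s : Set (MvPolynomial σ K)) := by
  classical
  rw [mem_ideal_span_X_image] at h ⊢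
  intro m hm
  obtain ⟨i, hi, hne⟩ := h (Finsupp.single j 1 + m) (by
    rw [mem_support_iff, coeff_X_mul]; exact mem_support_iff.mp hm)
  refine ⟨i, hi, ?_⟩
  have hij : j ≠ i := fun e => hj (e ▸ hi)
  simpa [Finsupp.single_apply, hij] using hne

theorem ofList_map_X (l : List σ) :
    Ideal.ofList (l.map (X : σ → MvPolynomial σ K)) = Ideal.span (X '' {i | i ∈ l}) := by
  unfold Ideal.ofList
  congr 1
  ext f
  simp

theorem one_notMem_span_X_image (s : Set σ) :
    (1 : MvPolynomial σ K) ∉ Ideal.span (X '' s : Set (MvPolynomial σ K)) := by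
  rw [mem_ideal_span_X_image]
  intro h
  obtain ⟨i, -, hi⟩ := h 0 (by simp)
  exact hi rfl

theorem isRegular_map_X {l : List σ} (hl : l.Nodup) :
    RingTheory.Sequence.IsRegular (MvPolynomial σ K) (l.map (X : σ → MvPolynomial σ K)) := by
  refine ⟨⟨fun i hi => ?_⟩, ?_⟩
  · rw [List.length_map] at hi
    rw [← List.map_take, ofList_map_X, isSMulRegular_quotient_iff_mem_of_smul_mem]
    intro f hf
    simp only [smul_eq_mul, Ideal.mul_top, List.getElem_map] at hf ⊢
    refine mem_span_X_image_of_X_mul_mem (fun hmem => ?_) hf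
    rw [Set.mem_ofPred_eq, List.mem_take_iff_getElem] at hmem
    obtain ⟨k, hk, he⟩ := hmem
    have := (List.Nodup.getElem_inj_iff hl).mp he
    omega
  · rw [ofList_map_X, smul_eq_mul, Ideal.mul_top]
    intro h
    exact one_notMem_span_X_image (K := K) {i | i ∈ l} (h ▸ Submodule.mem_top)

/-- The kernel of the substitution killing the variables in `s`. -/
noncomputable def killVars (K : Type*) [Field K] {σ : Type*} (s : Set σ) :
    Ideal (MvPolynomial σ K) :=
  RingHom.ker (aeval (R := K) (s.indicator 0 + sᶜ.indicator X : σ → MvPolynomial σ K))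

instance (s : Set σ) : (killVars K s).IsPrime := RingHom.ker_isPrime _

theorem X_mem_killVars_iff {s : Set σ} {i : σ} :
    (X i : MvPolynomial σ K) ∈ killVars K s ↔ i ∈ s := by
  classical
  by_cases h : i ∈ s <;> simp [killVars, RingHom.mem_ker, Set.indicator, h, X_ne_zero]

theorem killVars_le {s : Set σ} {P : Ideal (MvPolynomial σ K)} (h : ∀ i ∈ s, X i ∈ P) :
    killVars K s ≤ P := by
  classical
  have key : ∀ f : MvPolynomial σ K,
      f - aeval (R := K) (s.indicator 0 + sᶜ.indicator X : σ → MvPolynomial σ K) f ∈ P := by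
    intro f
    rw [← Ideal.Quotient.eq]
    induction f using MvPolynomial.induction_on with
    | C a => simp [algebraMap_eq]
    | add p q hp hq => simp only [map_add, ← hp, ← hq]
    | mul_X p i hp =>
      simp only [map_mul, ← hp, aeval_X]
      congr 1
      by_cases hi : i ∈ s
      · simpa [Set.indicator, hi] using Ideal.Quotient.eq_zero_iff_mem.mpr (h i hi)
      · simp [Set.indicator, hi]
  intro f hf
  have := key f
  rwa [show aeval (R := K) (s.indicator 0 + sᶜ.indicator X : σ → MvPolynomial σ K) f = 0 from hf,
    sub_zero] at this

theorem card_le_height_killVars (s : Finset σ) :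
    (s.card : ℕ∞) ≤ (killVars K (s : Set σ)).height := by
  classical
  induction s using Finset.induction_on with
  | empty => simp
  | insert a s ha ih =>
    rw [Finset.card_insert_of_notMem ha]
    have hlt : killVars K (s : Set σ) < killVars K ((insert a s : Finset σ) : Set σ) := by
      refine lt_of_le_of_ne (killVars_le fun i hi => X_mem_killVars_iff.mpr (by simp_all)) ?_
      intro h
      have : (X a : MvPolynomial σ K) ∈ killVars K (s : Set σ) :=
        h ▸ X_mem_killVars_iff.mpr (by simp)
      exact ha (by simpa using X_mem_killVars_iff.mp this)
    calc ((s.card + 1 : ℕ) : ℕ∞) = s.card + 1 := by push_cast; rfl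
      _ ≤ (killVars K (s : Set σ)).height + 1 := by gcongr
      _ ≤ _ := Ideal.height_add_one_le_of_lt_of_isPrime hlt

theorem idealHeight_eq_height {R : Type*} [CommRing R] (I : Ideal R) :
    idealHeight I = I.height := by
  unfold idealHeight
  refine le_antisymm ?_ ?_
  · rw [Ideal.height_eq_inf_minimalPrimes]
    refine le_iInf₂ fun P hP => ?_
    have := hP.isPrime
    exact (iInf₂_le (⟨P, hP.isPrime⟩ : PrimeSpectrum R) hP.1.2).trans
      (PrimeSpectrum.height_eq_orderHeight ⟨P, hP.isPrime⟩).ge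
  · refine le_iInf₂ fun P hP => ?_
    rw [← PrimeSpectrum.height_eq_orderHeight]
    exact Ideal.height_mono hP

theorem height_span_of_faithfullyFlat [Fintype σ] {T : Type*} [CommRing T] [IsNoetherianRing T]
    [Algebra (MvPolynomial σ K) T] [Module.FaithfullyFlat (MvPolynomial σ K) T] :
    (Ideal.span (Set.range fun i : σ => algebraMap (MvPolynomial σ K) T (X i))).height
      = Fintype.card σ := by
  classical
  set I := Ideal.span (Set.range fun i : σ => algebraMap (MvPolynomial σ K) T (X i)) with hI
  have hmap : I = (killVars K (Set.univ : Set σ)).map (algebraMap _ T) := by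
    apply le_antisymm
    · rw [hI, Ideal.span_le]
      rintro _ ⟨i, rfl⟩
      exact Ideal.mem_map_of_mem _ (X_mem_killVars_iff.mpr trivial)
    · rw [Ideal.map_le_iff_le_comap]
      exact killVars_le fun i _ => Ideal.subset_span ⟨i, rfl⟩
  have htop : I ≠ ⊤ := by
    rw [hmap]
    intro h
    have := Ideal.comap_map_eq_self_of_faithfullyFlat (B := T) (killVars K (Set.univ : Set σ))
    rw [h, Ideal.comap_top] at this
    exact Ideal.IsPrime.ne_top' this.symm
  apply le_antisymm
  · obtain ⟨P, hP⟩ := Ideal.nonempty_minimalPrimes htop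
    have := hP.isPrime
    have hspan : Ideal.span
        ((Finset.univ.image fun i : σ => algebraMap (MvPolynomial σ K) T (X i) : Finset T) : Set T)
          = I := by simp [hI]
    refine (Ideal.height_mono hP.1.2).trans ?_
    refine (Ideal.height_le_card_of_mem_minimalPrimes_span_finset (hspan ▸ hP)).trans ?_
    exact_mod_cast Finset.card_image_le
  · rw [Ideal.height_eq_inf_minimalPrimes]
    refine le_iInf₂ fun P hP => ?_
    have := hP.isPrime
    have hle : killVars K (Set.univ : Set σ) ≤ P.under (MvPolynomial σ K) := by
      rw [Ideal.under_def, ← Ideal.map_le_iff_le_comap, ← hmap]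
      exact hP.1.2
    have h1 := card_le_height_killVars (K := K) (Finset.univ : Finset σ)
    rw [Finset.coe_univ, Finset.card_univ] at h1
    refine h1.trans ((Ideal.height_mono hle).trans ?_)
    rw [Ideal.height_eq_height_add_of_liesOver_of_hasGoingDown (P.under (MvPolynomial σ K)) P]
    exact le_self_add

end PolynomialRing

section TriangularBasis

variable {K : Type*} [Field K]

theorem triangular_basis {T S : Type*} [AddCommGroup T] [Module K T] {e f : S → T} (μ : S → ℕ)
    (he : LinearIndependent K e) (hsp : ⊤ ≤ Submodule.span K (Set.range e))
    (hf : ∀ s, ∃ a : K, a ≠ 0 ∧ f s - a • e s ∈ Submodule.span K (e '' {s' | μ s' < μ s})) :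
    LinearIndependent K f ∧ ⊤ ≤ Submodule.span K (Set.range f) := by
  classical
  choose a ha hf using hf
  constructor
  · let b := Module.Basis.mk he hsp
    have hb : ∀ s, b s = e s := fun s => by simp [b]
    have hcoord : ∀ s s', s' ≠ s → μ s ≤ μ s' → b.repr (f s) s' = 0 := by
      intro s s' hne hle
      have h := hf s
      rw [← show (b : S → T) = e from funext hb, Module.Basis.mem_span_image] at h
      by_contra hc
      have hmem : s' ∈ (b.repr (f s - a s • b s)).support := by
        rw [Finsupp.mem_support_iff]
        simpa [Finsupp.single_apply, hne.symm] using hc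
      exact absurd (h hmem) (by simpa using hle)
    have hdiag : ∀ s, b.repr (f s) s = a s := by
      intro s
      have h := hf s
      rw [← show (b : S → T) = e from funext hb, Module.Basis.mem_span_image] at h
      by_contra hc
      have hmem : s ∈ (b.repr (f s - a s • b s)).support := by
        rw [Finsupp.mem_support_iff]
        simpa [sub_eq_zero] using hc
      simpa using h hmem
    rw [linearIndependent_iff]
    intro c hc
    by_contra hne
    obtain ⟨s, hs, hmax⟩ := c.support.exists_max_image μ (Finsupp.support_nonempty_iff.mpr hne)
    have h0 : b.repr (Finsupp.linearCombination K f c) s = 0 := by rw [hc]; simp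
    rw [Finsupp.linearCombination_apply, Finsupp.sum, map_sum, Finsupp.finsetSum_apply,
      Finset.sum_eq_single s] at h0
    · rw [map_smul, Finsupp.smul_apply, hdiag, smul_eq_mul] at h0
      exact (mul_ne_zero (Finsupp.mem_support_iff.mp hs) (ha s)) h0
    · intro s' hs' hss'
      rw [map_smul, Finsupp.smul_apply, hcoord s' s hss'.symm (hmax s' hs'), smul_zero]
    · exact fun h => absurd hs h
  · refine hsp.trans (Submodule.span_le.mpr ?_)
    rintro _ ⟨s, rfl⟩
    induction hn : μ s using Nat.strong_induction_on generalizing s with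
    | _ n ih =>
      subst hn
      have h1 : Submodule.span K (e '' {s' | μ s' < μ s}) ≤ Submodule.span K (Set.range f) := by
        rw [Submodule.span_le]
        rintro _ ⟨s', hs', rfl⟩
        exact ih (μ s') hs' s' rfl
      have h2 : a s • e s ∈ Submodule.span K (Set.range f) := by
        have := Submodule.sub_mem _ (Submodule.subset_span (Set.mem_range_self s)) (h1 (hf s))
        simpa using this
      exact (Submodule.smul_mem_iff _ (ha s)).mp h2

theorem free_of_basis_monomial_smul {Z C T : Type*} [CommRing T] [Algebra K T]
    [Algebra (MvPolynomial Z K) T] [IsScalarTower K (MvPolynomial Z K) T] (c : C → T)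
    (hli : LinearIndependent K
      (fun p : (_ : C) × (Z →₀ ℕ) => (monomial p.2 (1 : K) : MvPolynomial Z K) • c p.1))
    (hsp : ⊤ ≤ Submodule.span K (Set.range
      (fun p : (_ : C) × (Z →₀ ℕ) => (monomial p.2 (1 : K) : MvPolynomial Z K) • c p.1))) :
    Module.Free (MvPolynomial Z K) T := by
  classical
  let b₁ : Module.Basis ((_ : C) × (Z →₀ ℕ)) K (C →₀ MvPolynomial Z K) :=
    Finsupp.basis fun _ => basisMonomials Z K
  let b₂ := Module.Basis.mk hli hsp
  let E := b₁.equiv b₂ (Equiv.refl _)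
  let F := Finsupp.linearCombination (MvPolynomial Z K) c
  have hEF : (F.restrictScalars K) = E.toLinearMap := by
    refine b₁.ext fun p => ?_
    have hE : E (b₁ p) = b₂ p := by simp only [E, Module.Basis.equiv_apply, Equiv.refl_apply]
    change F (b₁ p) = E (b₁ p)
    rw [hE]
    simp [b₁, b₂, F, Finsupp.coe_basis]
  have hbij : Function.Bijective F := by
    have : (F : (C →₀ MvPolynomial Z K) → T) = E := by
      funext x
      exact LinearMap.congr_fun hEF x
    rw [this]
    exact E.bijective
  exact Module.Free.of_equiv (LinearEquiv.ofBijective F hbij)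

/-- The span of the monomials of weight less than `n`. -/
noncomputable def lowWeight (K : Type*) [Field K] {V : Type*} (w : V → ℕ) (n : ℕ) :
    Submodule K (MvPolynomial V K) :=
  Submodule.span K ((fun m => monomial m (1 : K)) '' {m | Finsupp.weight w m < n})

theorem monomial_mem_lowWeight {V : Type*} {w : V → ℕ} {n : ℕ} {m : V →₀ ℕ}
    (h : Finsupp.weight w m < n) (a : K) : monomial m a ∈ lowWeight K w n := by
  have : (monomial m a : MvPolynomial V K) = a • monomial m 1 := by simp [smul_monomial]
  rw [this]
  exact Submodule.smul_mem _ _ (Submodule.subset_span ⟨m, h, rfl⟩)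

theorem X_mul_mem_lowWeight {V : Type*} {w : V → ℕ} {n k : ℕ} {q : MvPolynomial V K}
    (hq : q ∈ lowWeight K w n) {v : V} (hv : n + w v ≤ k) : X v * q ∈ lowWeight K w k := by
  induction hq using Submodule.span_induction with
  | mem x hx =>
    obtain ⟨m, hm, rfl⟩ := hx
    have : X v * monomial m (1 : K) = monomial (Finsupp.single v 1 + m) 1 := by
      rw [X, monomial_mul, one_mul]
    simp only [this]
    refine monomial_mem_lowWeight ?_ _
    have hm' : Finsupp.weight w m < n := hm
    rw [map_add, Finsupp.weight_single, one_smul]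
    omega
  | zero => simp
  | add x y _ _ hx hy => rw [mul_add]; exact add_mem hx hy
  | smul a x _ hx => rw [mul_smul_comm]; exact Submodule.smul_mem _ _ hx

theorem free_of_standard_monomials {T V Z : Type*} [CommRing T] [Algebra K T]
    [Algebra (MvPolynomial Z K) T] [IsScalarTower K (MvPolynomial Z K) T]
    (π : MvPolynomial V K →ₐ[K] T) (hπ : Function.Surjective π) (S : Set (V →₀ ℕ)) (w : V → ℕ)
    (hli : LinearIndependent K (fun σ : S => π (monomial σ.1 1)))
    (hsp : ∀ σ, π (monomial σ 1) ∈ Submodule.span K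
      ((fun τ => π (monomial τ 1)) '' {τ | τ ∈ S ∧ Finsupp.weight w τ ≤ Finsupp.weight w σ}))
    (ι κ : Z → V) (hι : Function.Injective ι) (hw : ∀ z, w (κ z) < w (ι z))
    (hadd : ∀ σ ∈ S, ∀ α : Z →₀ ℕ, σ + α.mapDomain ι ∈ S) (hdown : IsLowerSet S)
    (ε : Z → K) (hε : ∀ z, ε z ≠ 0)
    (hθ : ∀ z, algebraMap (MvPolynomial Z K) T (X z) = ε z • (π (X (ι z)) - π (X (κ z)))) :
    Module.Free (MvPolynomial Z K) T := by
  classical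
  let C := {σ : V →₀ ℕ // σ ∈ S ∧ ∀ z, σ (ι z) = 0}
  let g : ((_ : C) × (Z →₀ ℕ)) → S := fun p => ⟨p.1.1 + p.2.mapDomain ι, hadd _ p.1.2.1 _⟩
  have hg : Function.Bijective g := by
    constructor
    · rintro ⟨⟨c, hc, hc0⟩, α⟩ ⟨⟨c', hc', hc0'⟩, α'⟩ h
      have h : c + α.mapDomain ι = c' + α'.mapDomain ι := congrArg Subtype.val h
      have hα : α = α' := by
        ext z
        have := DFunLike.congr_fun h (ι z)
        simpa [hc0, hc0', Finsupp.mapDomain_apply hι] using this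
      subst hα
      have : c = c' := add_right_cancel h
      subst this
      rfl
    · rintro ⟨σ, hσ⟩
      have hle : (σ.comapDomain ι hι.injOn).mapDomain ι ≤ σ := by
        intro v
        by_cases hv : v ∈ Set.range ι
        · obtain ⟨z, rfl⟩ := hv
          rw [Finsupp.mapDomain_apply hι, Finsupp.comapDomain_apply]
        · rw [Finsupp.mapDomain_of_notMem_range _ _ hv]
          exact Nat.zero_le _
      refine ⟨⟨⟨σ - (σ.comapDomain ι hι.injOn).mapDomain ι, hdown tsub_le_self hσ, fun z => ?_⟩,
        σ.comapDomain ι hι.injOn⟩, Subtype.ext ?_⟩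
      · simp [Finsupp.mapDomain_apply hι]
      · exact tsub_add_cancel_of_le hle
  have key : ∀ (α : Z →₀ ℕ) (σ : V →₀ ℕ), ∃ a : K, a ≠ 0 ∧
      ∃ q ∈ lowWeight K w (Finsupp.weight w (σ + α.mapDomain ι)),
        (monomial α (1 : K) : MvPolynomial Z K) • π (monomial σ 1)
          = π (monomial (σ + α.mapDomain ι) a + q) := by
    intro α σ
    obtain ⟨s, rfl⟩ := Multiset.toFinsupp.surjective α
    induction s using Multiset.induction_on with
    | empty => exact ⟨1, one_ne_zero, 0, zero_mem _, by simp⟩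
    | cons z s ih =>
      obtain ⟨a, ha, q, hq, heq⟩ := ih
      set τ := σ + (Multiset.toFinsupp s).mapDomain ι with hτ
      have hz : Multiset.toFinsupp (z ::ₘ s) = Finsupp.single z 1 + Multiset.toFinsupp s := by
        rw [← Multiset.singleton_add, map_add, Multiset.toFinsupp_singleton]
      have hτz : σ + (Multiset.toFinsupp (z ::ₘ s)).mapDomain ι = Finsupp.single (ι z) 1 + τ := by
        rw [hz, Finsupp.mapDomain_add, Finsupp.mapDomain_single, hτ]
        abel
      rw [hτz]
      refine ⟨ε z * a, mul_ne_zero (hε z) ha,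
        ε z • (X (ι z) * q) - ε z • (X (κ z) * monomial τ a) - ε z • (X (κ z) * q), ?_, ?_⟩
      · have hwt : Finsupp.weight w (Finsupp.single (ι z) 1 + τ)
            = w (ι z) + Finsupp.weight w τ := by
          rw [map_add, Finsupp.weight_single, one_smul]
        rw [hwt]
        refine sub_mem (sub_mem (Submodule.smul_mem _ _ (X_mul_mem_lowWeight hq (by omega)))
          (Submodule.smul_mem _ _ ?_))
          (Submodule.smul_mem _ _ (X_mul_mem_lowWeight hq (by have := hw z; omega)))
        rw [X, monomial_mul, one_mul]
        refine monomial_mem_lowWeight ?_ _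
        rw [map_add, Finsupp.weight_single, one_smul]
        have := hw z
        omega
      · have hX : (monomial (Multiset.toFinsupp (z ::ₘ s)) (1 : K) : MvPolynomial Z K)
            = X z * monomial (Multiset.toFinsupp s) 1 := by
          rw [hz, X, monomial_mul, one_mul]
        have hX' : (monomial (Finsupp.single (ι z) 1 + τ) (ε z * a) : MvPolynomial V K)
            = ε z • (X (ι z) * monomial τ a) := by
          rw [X, monomial_mul, one_mul, smul_monomial, smul_eq_mul]
        rw [hX, mul_smul, heq, Algebra.smul_def, hθ, ← map_sub, ← map_smul, ← map_mul, hX']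
        congr 1
        simp only [smul_mul_assoc, sub_mul, mul_add, smul_sub]
        abel
  have hlow : ∀ (n : ℕ) (q), q ∈ lowWeight K w n → π q ∈ Submodule.span K
      ((fun p => π (monomial (g p).1 1)) '' {p | Finsupp.weight w (g p).1 < n}) := by
    intro n q hq
    have : lowWeight K w n ≤ (Submodule.span K
      ((fun p => π (monomial (g p).1 1)) '' {p | Finsupp.weight w (g p).1 < n})).comap
        π.toLinearMap := by
      rw [lowWeight, Submodule.span_le]
      rintro _ ⟨m, hm, rfl⟩
      refine Submodule.span_mono ?_ (hsp m)
      rintro _ ⟨τ, ⟨hτS, hτ⟩, rfl⟩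
      obtain ⟨p, hp⟩ := hg.2 ⟨τ, hτS⟩
      refine ⟨p, ?_, by simp [hp]⟩
      have hm' : Finsupp.weight w m < n := hm
      simp only [Set.mem_ofPred_eq, hp]
      omega
    exact this hq
  have hspan : ⊤ ≤ Submodule.span K (Set.range fun p => π (monomial (g p).1 1)) := by
    intro x _
    obtain ⟨f, rfl⟩ := hπ x
    induction f using MvPolynomial.induction_on' with
    | monomial m a =>
      have h := Submodule.span_mono (Set.image_subset_range _ _)
        (hlow _ _ (monomial_mem_lowWeight (Nat.lt_succ_self (Finsupp.weight w m)) a))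
      exact h
    | add p q hp hq => rw [map_add]; exact add_mem (hp trivial) (hq trivial)
  obtain ⟨h1, h2⟩ := triangular_basis (K := K)
    (e := fun p => π (monomial (g p).1 1))
    (f := fun p => (monomial p.2 (1 : K) : MvPolynomial Z K) • π (monomial p.1.1 1))
    (fun p => Finsupp.weight w (g p).1) (hli.comp g hg.1) hspan (by
      intro p
      obtain ⟨a, ha, q, hq, heq⟩ := key p.2 p.1.1
      refine ⟨a, ha, ?_⟩
      have : (monomial (g p).1 a : MvPolynomial V K) = a • monomial (g p).1 1 := by
        simp [smul_monomial]
      simp only [heq]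
      rw [map_add π, show p.1.1 + p.2.mapDomain ι = (g p).1 from rfl, this, map_smul,
        add_sub_cancel_left]
      exact hlow _ _ hq)
  exact free_of_basis_monomial_smul (fun c : C => π (monomial c.1 1)) h1 h2

end TriangularBasis

section StandardMonomials

/-- The set `s` contains an antidiagonal of length `n`, listed from north-east to south-west. -/
def HasAntidiagonal (s : Set (ℕ × ℕ)) (n : ℕ) : Prop :=
  ∃ r cc : Fin n → ℕ, StrictMono r ∧ StrictAnti cc ∧ ∀ a, (r a, cc a) ∈ s

theorem HasAntidiagonal.mono {s s' : Set (ℕ × ℕ)} {n : ℕ} (h : HasAntidiagonal s n) (hs : s ⊆ s') :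
    HasAntidiagonal s' n :=
  let ⟨r, cc, hr, hcc, hmem⟩ := h
  ⟨r, cc, hr, hcc, fun a => hs (hmem a)⟩

/-- The positions of the variables occurring in a monomial. -/
def positions {V : Set (ℕ × ℕ)} (σ : V →₀ ℕ) : Set (ℕ × ℕ) :=
  {p | ∃ h : p ∈ V, σ ⟨p, h⟩ ≠ 0}

/-- A monomial is standard if it involves no antidiagonal of length `t j` in the region with
south-west corner `(d j, c j)`, for every `j`. -/
def IsStandard {V : Set (ℕ × ℕ)} {J : Type*} (d c t : J → ℕ) (σ : V →₀ ℕ) : Prop :=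
  ∀ j, ¬ HasAntidiagonal {p ∈ positions σ | p.1 ≤ d j ∧ c j ≤ p.2} (t j)

/-- The mixed determinantal ideal of `V` with lower outside corners `(d j, c j)`. -/
noncomputable def mixedIdeal (K : Type*) [Field K] (V : Set (ℕ × ℕ)) {J : Type*}
    (d c t : J → ℕ) : Ideal (MvPolynomial V K) :=
  ⨆ j, minorsIdeal K V {p ∈ V | p.1 ≤ d j ∧ c j ≤ p.2} (t j)

/-- The defining property of a two-sided ladder. -/
def IsLadder (V : Set (ℕ × ℕ)) : Prop :=
  ∀ p ∈ V, ∀ q ∈ V, ∀ x y, p.1 ≤ x → x ≤ q.1 → q.2 ≤ y → y ≤ p.2 → (x, y) ∈ V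

theorem isLowerSet_isStandard {V : Set (ℕ × ℕ)} {J : Type*} (d c t : J → ℕ) :
    IsLowerSet {σ : V →₀ ℕ | IsStandard d c t σ} := by
  intro σ τ hle hσ j h
  refine hσ j (h.mono ?_)
  rintro p ⟨⟨hp, hne⟩, hreg⟩
  exact ⟨⟨hp, fun h0 => hne (Nat.le_zero.mp (h0 ▸ hle ⟨p, hp⟩))⟩, hreg⟩

theorem sum_weight_perm_lt {n : ℕ} {r cc : Fin n → ℕ} (hr : StrictMono r) (hcc : StrictAnti cc)
    {w : ℕ × ℕ → ℕ} {f g : ℕ → ℤ} (hw : ∀ u v, (w (u, v) : ℤ) = f u + g v - 2 * (u * v))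
    {π : Equiv.Perm (Fin n)} (hπ : π ≠ 1) :
    ∑ a, w (r (π a), cc a) < ∑ a, w (r a, cc a) := by
  have hanti : Antivary (fun a => (r a : ℤ)) (fun a => (cc a : ℤ)) := by
    intro a b hab
    have hab' : (cc a : ℤ) < cc b := hab
    have h : b < a := hcc.lt_iff_gt.mp (by exact_mod_cast hab')
    show (r b : ℤ) ≤ r a
    exact_mod_cast (hr h).le
  have hlt : ∑ a, (r a : ℤ) * cc a < ∑ a, (r (π a) : ℤ) * cc a := by
    refine hanti.sum_mul_lt_sum_comp_perm_mul_iff.mpr fun h => hπ ?_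
    have hmono : Monotone π := by
      intro a b hab
      rcases hab.eq_or_lt with rfl | hab
      · exact le_rfl
      have : (r (π a) : ℤ) ≤ r (π b) := h (show ((cc b : ℕ) : ℤ) < cc a by exact_mod_cast hcc hab)
      exact hr.le_iff_le.mp (by exact_mod_cast this)
    have hstrict : StrictMono π := hmono.strictMono_of_injective π.injective
    have : (hstrict.orderIsoOfSurjective π π.surjective) = OrderIso.refl (Fin n) :=
      Subsingleton.elim _ _
    ext a
    have := congrArg (fun e : Fin n ≃o Fin n => e a) this
    simpa using congrArg Fin.val this
  have h1 : ∑ a, f (r (π a)) = ∑ a, f (r a) := Equiv.sum_comp π fun a => f (r a)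
  have : (∑ a, (w (r (π a), cc a) : ℤ)) < ∑ a, (w (r a, cc a) : ℤ) := by
    simp only [hw, Finset.sum_sub_distrib, Finset.sum_add_distrib, ← Finset.mul_sum, h1]
    linarith
  exact_mod_cast this

variable {K : Type*} [Field K] {V : Set (ℕ × ℕ)} {J : Type*} {d c t : J → ℕ}

theorem monomial_mem_span_standard (hV : IsLadder V) {w : ℕ × ℕ → ℕ} {f g : ℕ → ℤ}
    (hw : ∀ u v, (w (u, v) : ℤ) = f u + g v - 2 * (u * v)) (σ : V →₀ ℕ) :
    Ideal.Quotient.mk (mixedIdeal K V d c t) (monomial σ 1) ∈ Submodule.span K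
      ((fun τ => Ideal.Quotient.mk (mixedIdeal K V d c t) (monomial τ (1 : K))) ''
        {τ | IsStandard d c t τ ∧
          Finsupp.weight (fun p : V => w p) τ ≤ Finsupp.weight (fun p : V => w p) σ}) := by
  classical
  induction hn : Finsupp.weight (fun p : V => w p) σ using Nat.strong_induction_on
    generalizing σ with
  | _ n ih =>
    subst hn
    by_cases hσ : IsStandard d c t σ
    · exact Submodule.subset_span ⟨σ, ⟨hσ, le_rfl⟩, rfl⟩
    simp only [IsStandard, not_forall, not_not] at hσ
    obtain ⟨j, r, cc, hr, hcc, hmem⟩ := hσ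
    have hmemV : ∀ a b, (r a, cc b) ∈ V := by
      intro a b
      obtain ⟨⟨ha, -⟩, -⟩ := hmem a
      obtain ⟨⟨hb, -⟩, -⟩ := hmem b
      rcases le_total a b with hab | hab
      · exact hV _ ha _ hb _ _ le_rfl (hr.monotone hab) le_rfl (hcc.antitone hab)
      · exact hV _ hb _ ha _ _ (hr.monotone hab) le_rfl (hcc.antitone hab) le_rfl
    let v : Fin (t j) → Fin (t j) → V := fun a b => ⟨(r a, cc b), hmemV a b⟩
    let M : Matrix (Fin (t j)) (Fin (t j)) (MvPolynomial V K) := Matrix.of fun a b => X (v a b)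
    have hdet : M.det ∈ mixedIdeal K V d c t := by
      have hminor : (M.submatrix id Fin.revPerm).det ∈ mixedIdeal K V d c t := by
        refine Ideal.mem_iSup_of_mem j (Ideal.subset_span
          ⟨r, fun b => cc (Fin.rev b), hr, fun a b hab => hcc (Fin.rev_lt_rev.mpr hab),
            fun a b => ⟨hmemV _ _, (hmem a).2.1, (hmem (Fin.rev b)).2.2⟩,
            fun a b => hmemV _ _, rfl⟩)
      have hM : M = (M.submatrix id Fin.revPerm).submatrix id Fin.revPerm := by
        ext a b : 2
        simp
      rw [hM, Matrix.det_permute']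
      exact Ideal.mul_mem_left _ _ hminor
    have hle : ∑ a, Finsupp.single (v a a) 1 ≤ σ := by
      intro x
      rw [Finsupp.finsetSum_apply]
      by_cases hx : ∃ a, v a a = x
      · obtain ⟨a, rfl⟩ := hx
        rw [Finset.sum_eq_single a]
        · rw [Finsupp.single_eq_same]
          obtain ⟨⟨h, hne⟩, -⟩ := hmem a
          exact Nat.one_le_iff_ne_zero.mpr hne
        · intro b _ hb
          refine Finsupp.single_eq_of_ne fun h => hb (hr.injective ?_)
          exact (congrArg (fun p : V => p.1.1) h).symm
        · simp
      · rw [Finset.sum_eq_zero]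
        · exact Nat.zero_le _
        · exact fun a _ => Finsupp.single_eq_of_ne fun h => hx ⟨a, h.symm⟩
    obtain ⟨σ₀, rfl⟩ := exists_add_of_le hle
    have hprod : ∀ π : Equiv.Perm (Fin (t j)), (∏ a, M (π a) a : MvPolynomial V K)
        = monomial (∑ a, Finsupp.single (v (π a) a) 1) 1 := by
      intro π
      rw [monomial_sum_one]
      rfl
    have hsum : ∑ π : Equiv.Perm (Fin (t j)), (Equiv.Perm.sign π : ℤ) •
        Ideal.Quotient.mk (mixedIdeal K V d c t)
          (monomial (∑ a, Finsupp.single (v (π a) a) 1 + σ₀) (1 : K)) = 0 := by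
      have h0 := Ideal.Quotient.eq_zero_iff_mem.mpr
        (Ideal.mul_mem_right (monomial σ₀ (1 : K)) _ hdet)
      rw [Matrix.det_apply, Finset.sum_mul, map_sum] at h0
      rw [← h0]
      refine Finset.sum_congr rfl fun π _ => ?_
      rw [hprod, Units.smul_def, smul_mul_assoc, monomial_mul, one_mul, map_zsmul]
    rw [← Finset.add_sum_erase _ _ (Finset.mem_univ (1 : Equiv.Perm (Fin (t j)))),
      add_eq_zero_iff_eq_neg] at hsum
    simp only [Equiv.Perm.sign_one, Units.val_one, one_smul, Equiv.Perm.one_apply] at hsum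
    rw [hsum]
    refine Submodule.neg_mem _ (Submodule.sum_mem _ fun π hπ => zsmul_mem ?_ _)
    have hwt : ∀ π : Equiv.Perm (Fin (t j)), Finsupp.weight (fun p : V => w p)
        (∑ a, Finsupp.single (v (π a) a) 1 + σ₀)
        = ∑ a, w (r (π a), cc a) + Finsupp.weight (fun p : V => w p) σ₀ := by
      intro π
      rw [map_add, map_sum]
      simp [Finsupp.weight_single, v]
    have hlt : Finsupp.weight (fun p : V => w p) (∑ a, Finsupp.single (v (π a) a) 1 + σ₀)
        < Finsupp.weight (fun p : V => w p) (∑ a, Finsupp.single (v a a) 1 + σ₀) := by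
      have h1 := hwt 1
      simp only [Equiv.Perm.one_apply] at h1
      rw [hwt, h1]
      have := sum_weight_perm_lt hr hcc hw (Finset.ne_of_mem_erase hπ)
      omega
    refine Submodule.span_mono (Set.image_mono ?_) (ih _ hlt _ rfl)
    rintro τ ⟨h1, h2⟩
    exact ⟨h1, h2.trans hlt.le⟩

end StandardMonomials

section LayeredMonomials

variable {α β : Type*}

theorem Finsupp.weight_le_weight {w w' : α → ℕ} {ρ : α →₀ ℕ} (h : ∀ z ∈ ρ.support, w z ≤ w' z) :
    Finsupp.weight w ρ ≤ Finsupp.weight w' ρ := by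
  rw [Finsupp.weight_apply, Finsupp.weight_apply]
  exact Finset.sum_le_sum fun z hz => Nat.mul_le_mul_left _ (h z hz)

theorem Finsupp.weight_add_weight (w w' : α → ℕ) (ρ : α →₀ ℕ) :
    Finsupp.weight w ρ + Finsupp.weight w' ρ = Finsupp.weight (fun z => w z + w' z) ρ := by
  simp only [Finsupp.weight_apply, smul_eq_mul, Nat.mul_add]
  exact Finset.sum_add_distrib.symm

theorem Finsupp.sum_weight {ι : Type*} (I : Finset ι) (w : ι → α → ℕ) (ρ : α →₀ ℕ) :
    ∑ i ∈ I, Finsupp.weight (w i) ρ = Finsupp.weight (fun z => ∑ i ∈ I, w i z) ρ := by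
  simp only [Finsupp.weight_apply, smul_eq_mul, Finset.mul_sum]
  exact Finset.sum_comm

theorem Finsupp.weight_weight (w : β → ℕ) (g : α → β →₀ ℕ) (ρ : α →₀ ℕ) :
    Finsupp.weight w (Finsupp.weight g ρ) = Finsupp.weight (fun z => Finsupp.weight w (g z)) ρ := by
  rw [Finsupp.weight_apply g, Finsupp.sum, map_sum, Finsupp.weight_apply, Finsupp.sum]
  simp only [map_nsmul]

variable {V : Set (ℕ × ℕ)}

/-- The row and column content, layer by layer, of a monomial in layered variables. -/
noncomputable def layeredContent : (V × ℕ →₀ ℕ) →+ ((ℕ × ℕ) ⊕ (ℕ × ℕ) →₀ ℕ) :=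
  Finsupp.weight fun z : V × ℕ =>
    Finsupp.single (Sum.inl (z.2, z.1.1.1)) 1 + Finsupp.single (Sum.inr (z.2, z.1.1.2)) 1

/-- The number of variables weakly to the south-east of `(x, y)`. -/
noncomputable def southEastCount (σ : V →₀ ℕ) (x y : ℕ) : ℕ :=
  Finsupp.weight (fun p : V => if x ≤ p.1.1 ∧ y ≤ p.1.2 then 1 else 0) σ

/-- The number of variables of layer `i` weakly to the south-east of `(x, y)`. -/
noncomputable def layerCount (ρ : V × ℕ →₀ ℕ) (i x y : ℕ) : ℕ :=
  Finsupp.weight (fun z : V × ℕ => if z.2 = i ∧ x ≤ z.1.1.1 ∧ y ≤ z.1.1.2 then 1 else 0) ρ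

theorem layerCount_le_row (ρ : V × ℕ →₀ ℕ) (i x y : ℕ) :
    layerCount ρ i x y ≤ layerCount ρ i x 0 :=
  Finsupp.weight_le_weight fun z _ => by split_ifs <;> omega

theorem layerCount_le_col (ρ : V × ℕ →₀ ℕ) (i x y : ℕ) :
    layerCount ρ i x y ≤ layerCount ρ i 0 y :=
  Finsupp.weight_le_weight fun z _ => by split_ifs <;> omega

theorem layerCount_row_eq_of_content (ρ : V × ℕ →₀ ℕ) (i x : ℕ) :
    layerCount ρ i x 0 = Finsupp.weight
      (Sum.elim (fun q : ℕ × ℕ => if q.1 = i ∧ x ≤ q.2 then 1 else 0) fun _ => 0)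
      (layeredContent ρ) := by
  rw [layeredContent, Finsupp.weight_weight]
  simp [layerCount, Finsupp.weight_single]

theorem layerCount_col_eq_of_content (ρ : V × ℕ →₀ ℕ) (i y : ℕ) :
    layerCount ρ i 0 y = Finsupp.weight
      (Sum.elim (fun _ => 0) fun q : ℕ × ℕ => if q.1 = i ∧ y ≤ q.2 then 1 else 0)
      (layeredContent ρ) := by
  rw [layeredContent, Finsupp.weight_weight]
  simp [layerCount, Finsupp.weight_single]

/-- Each layer of `ρ` is a chain for the componentwise order on positions. -/
def IsLayeredChain (ρ : V × ℕ →₀ ℕ) : Prop :=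
  ∀ z ∈ ρ.support, ∀ z' ∈ ρ.support, z.2 = z'.2 →
    ¬ (z'.1.1.1 < z.1.1.1 ∧ z.1.1.2 < z'.1.1.2)

theorem IsLayeredChain.layerCount_eq {ρ : V × ℕ →₀ ℕ} (hρ : IsLayeredChain ρ) (i x y : ℕ) :
    layerCount ρ i x 0 ≤ layerCount ρ i x y ∨ layerCount ρ i 0 y ≤ layerCount ρ i x y := by
  by_cases h : ∀ z ∈ ρ.support, z.2 = i → x ≤ z.1.1.1 → y ≤ z.1.1.2
  · refine Or.inl (Finsupp.weight_le_weight fun z hz => ?_)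
    have := h z hz
    split_ifs <;> omega
  · push Not at h
    obtain ⟨z, hz, hi, hx, hy⟩ := h
    refine Or.inr (Finsupp.weight_le_weight fun z' hz' => ?_)
    have := hρ z hz z' hz'
    split_ifs <;> omega

theorem IsLayeredChain.layerCount_le {ρ ρ' : V × ℕ →₀ ℕ} (hρ : IsLayeredChain ρ)
    (h : layeredContent ρ' = layeredContent ρ) (i x y : ℕ) :
    layerCount ρ' i x y ≤ layerCount ρ i x y := by
  rcases hρ.layerCount_eq i x y with h1 | h1
  · refine (layerCount_le_row _ _ _ _).trans (le_trans (le_of_eq ?_) h1)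
    rw [layerCount_row_eq_of_content, layerCount_row_eq_of_content, h]
  · refine (layerCount_le_col _ _ _ _).trans (le_trans (le_of_eq ?_) h1)
    rw [layerCount_col_eq_of_content, layerCount_col_eq_of_content, h]

/-- Forgetting the layers of a layered monomial. -/
noncomputable def forgetLayers : (V × ℕ →₀ ℕ) →+ (V →₀ ℕ) :=
  Finsupp.weight fun z : V × ℕ => Finsupp.single z.1 1

theorem southEastCount_forgetLayers {ρ : V × ℕ →₀ ℕ} {I : Finset ℕ}
    (hI : ∀ z ∈ ρ.support, z.2 ∈ I) (x y : ℕ) :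
    southEastCount (forgetLayers ρ) x y = ∑ i ∈ I, layerCount ρ i x y := by
  simp only [southEastCount, forgetLayers, Finsupp.weight_weight, layerCount, Finsupp.sum_weight]
  simp only [Finsupp.weight_apply]
  refine Finset.sum_congr rfl fun z hz => ?_
  have := hI z hz
  simp [ite_and, this]

theorem apply_add_layerCount (ρ : V × ℕ →₀ ℕ) (z : V × ℕ) :
    ρ z + (layerCount ρ z.2 (z.1.1.1 + 1) z.1.1.2 + layerCount ρ z.2 z.1.1.1 (z.1.1.2 + 1)) =
      layerCount ρ z.2 z.1.1.1 z.1.1.2 +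
        layerCount ρ z.2 (z.1.1.1 + 1) (z.1.1.2 + 1) := by
  classical
  have h : ρ z = Finsupp.weight (fun z' => if z' = z then 1 else 0) ρ := by
    rw [Finsupp.weight_apply, Finsupp.sum_eq_single z] <;> simp +contextual
  rw [h]
  simp only [layerCount, Finsupp.weight_add_weight]
  congr 1
  congr 1
  ext z'
  obtain ⟨⟨⟨u, v⟩, hp⟩, i⟩ := z
  obtain ⟨⟨⟨u', v'⟩, hp'⟩, i'⟩ := z'
  simp only [Prod.mk.injEq, Subtype.mk.injEq]
  split_ifs <;> omega

theorem eq_of_layerCount_eq {ρ ρ' : V × ℕ →₀ ℕ}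
    (h : ∀ i x y, layerCount ρ i x y = layerCount ρ' i x y) : ρ = ρ' := by
  ext z
  have h1 := apply_add_layerCount ρ z
  have h2 := apply_add_layerCount ρ' z
  simp only [h] at h1
  omega

theorem IsLayeredChain.eq_of_content_eq {ρ ρ' : V × ℕ →₀ ℕ} (hρ : IsLayeredChain ρ)
    (h : layeredContent ρ' = layeredContent ρ)
    (hmin : southEastCount (forgetLayers ρ') ≤ southEastCount (forgetLayers ρ) →
      southEastCount (forgetLayers ρ) ≤ southEastCount (forgetLayers ρ')) : ρ' = ρ := by
  classical
  set I := (ρ.support ∪ ρ'.support).image Prod.snd with hIdef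
  have hI : ∀ z ∈ ρ.support, z.2 ∈ I := fun z hz =>
    Finset.mem_image_of_mem _ (Finset.mem_union_left _ hz)
  have hI' : ∀ z ∈ ρ'.support, z.2 ∈ I := fun z hz =>
    Finset.mem_image_of_mem _ (Finset.mem_union_right _ hz)
  have hle := hmin fun x y => by
    rw [southEastCount_forgetLayers hI, southEastCount_forgetLayers hI']
    exact Finset.sum_le_sum fun i _ => hρ.layerCount_le h i x y
  refine eq_of_layerCount_eq fun i x y => ?_
  by_cases hi : i ∈ I
  · have := hle x y
    rw [southEastCount_forgetLayers hI, southEastCount_forgetLayers hI'] at this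
    have heq := le_antisymm (Finset.sum_le_sum fun i _ => hρ.layerCount_le h i x y) this
    exact (Finset.sum_eq_sum_iff_of_le fun i _ => hρ.layerCount_le h i x y).mp heq i hi
  · have h0 : ∀ ρ : V × ℕ →₀ ℕ, (∀ z ∈ ρ.support, z.2 ∈ I) → layerCount ρ i x y = 0 := by
      intro ρ hρ
      rw [layerCount, Finsupp.weight_apply]
      refine Finset.sum_eq_zero fun z hz => ?_
      refine (congrArg (ρ z • ·) (if_neg ?_)).trans (smul_zero _)
      rintro ⟨rfl, -⟩
      exact hi (hρ z hz)
    rw [h0 _ hI, h0 _ hI']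

end LayeredMonomials

section Independence

open Classical in
/-- The length of the longest antidiagonal of `s` strictly to the north-east of `p`,
when `p ∈ s`, and `0` otherwise. -/
noncomputable def layer (s : Set (ℕ × ℕ)) (p : ℕ × ℕ) : ℕ :=
  Nat.findGreatest (fun n => p ∈ s ∧ HasAntidiagonal {q ∈ s | q.1 < p.1 ∧ p.2 < q.2} n) p.1

theorem layer_of_notMem {s : Set (ℕ × ℕ)} {p : ℕ × ℕ} (hp : p ∉ s) : layer s p = 0 := by
  classical
  rw [layer, Nat.findGreatest_eq_zero_iff]
  exact fun _ _ _ h => hp h.1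

theorem hasAntidiagonal_succ {s : Set (ℕ × ℕ)} {p : ℕ × ℕ} {n : ℕ} (hp : p ∈ s)
    (h : HasAntidiagonal {q ∈ s | q.1 < p.1 ∧ p.2 < q.2} n) :
    HasAntidiagonal {q ∈ s | q.1 ≤ p.1 ∧ p.2 ≤ q.2} (n + 1) := by
  obtain ⟨r, cc, hr, hcc, hmem⟩ := h
  refine ⟨Fin.snoc r p.1, Fin.snoc cc p.2, ?_, ?_, ?_⟩
  · intro a b hab
    induction b using Fin.lastCases with
    | last =>
      induction a using Fin.lastCases with
      | last => exact absurd hab (lt_irrefl _)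
      | cast a => simpa using (hmem a).2.1
    | cast b =>
      induction a using Fin.lastCases with
      | last => exact absurd hab (not_lt.mpr (Fin.le_last _))
      | cast a => simpa using hr (Fin.castSucc_lt_castSucc_iff.mp hab)
  · intro a b hab
    induction b using Fin.lastCases with
    | last =>
      induction a using Fin.lastCases with
      | last => exact absurd hab (lt_irrefl _)
      | cast a => simpa using (hmem a).2.2
    | cast b =>
      induction a using Fin.lastCases with
      | last => exact absurd hab (not_lt.mpr (Fin.le_last _))
      | cast a => simpa using hcc (Fin.castSucc_lt_castSucc_iff.mp hab)
  · intro a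
    induction a using Fin.lastCases with
    | last => simpa using hp
    | cast a =>
      obtain ⟨h1, h2, h3⟩ := hmem a
      simp only [Fin.snoc_castSucc]
      exact ⟨h1, h2.le, h3.le⟩

theorem HasAntidiagonal.of_le {s : Set (ℕ × ℕ)} {m n : ℕ} (h : HasAntidiagonal s n) (hmn : m ≤ n) :
    HasAntidiagonal s m := by
  obtain ⟨r, cc, hr, hcc, hmem⟩ := h
  exact ⟨r ∘ Fin.castLE hmn, cc ∘ Fin.castLE hmn, hr.comp (Fin.strictMono_castLE hmn),
    hcc.comp_strictMono (Fin.strictMono_castLE hmn), fun a => hmem _⟩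

theorem hasAntidiagonal_layer {s : Set (ℕ × ℕ)} {p : ℕ × ℕ} (hp : p ∈ s) :
    HasAntidiagonal {q ∈ s | q.1 < p.1 ∧ p.2 < q.2} (layer s p) := by
  classical
  have h0 : HasAntidiagonal {q ∈ s | q.1 < p.1 ∧ p.2 < q.2} 0 :=
    ⟨Fin.elim0, Fin.elim0, fun a => a.elim0, fun a => a.elim0, fun a => a.elim0⟩
  exact (Nat.findGreatest_spec (P := fun n => p ∈ s ∧
    HasAntidiagonal {q ∈ s | q.1 < p.1 ∧ p.2 < q.2} n) (Nat.zero_le _) ⟨hp, h0⟩).2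

theorem layer_succ_lt {s : Set (ℕ × ℕ)} {p : ℕ × ℕ} {n : ℕ} (hp : p ∈ s)
    (h : ¬ HasAntidiagonal {q ∈ s | q.1 ≤ p.1 ∧ p.2 ≤ q.2} n) : layer s p + 1 < n := by
  by_contra! hle
  exact h ((hasAntidiagonal_succ hp (hasAntidiagonal_layer hp)).of_le hle)

theorem layer_lt_layer {s : Set (ℕ × ℕ)} {p q : ℕ × ℕ} (hp : p ∈ s) (hq : q ∈ s)
    (h1 : q.1 < p.1) (h2 : p.2 < q.2) : layer s q < layer s p := by
  classical
  have h : HasAntidiagonal {x ∈ s | x.1 < p.1 ∧ p.2 < x.2} (layer s q + 1) :=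
    (hasAntidiagonal_succ hq (hasAntidiagonal_layer hq)).mono fun x hx =>
      ⟨hx.1, hx.2.1.trans_lt h1, h2.trans_le hx.2.2⟩
  have hle : layer s q + 1 ≤ p.1 := by
    have : layer s q ≤ q.1 := Nat.findGreatest_le _
    omega
  exact Nat.le_findGreatest (P := fun n => p ∈ s ∧
    HasAntidiagonal {x ∈ s | x.1 < p.1 ∧ p.2 < x.2} n) hle ⟨hp, h⟩

variable {K : Type*} [Field K] {V : Set (ℕ × ℕ)} {J : Type*} {d c t : J → ℕ}

/-- Layer `i` may occur at position `p`: no region containing `p` has too small a minor size. -/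
def LayerAllowed (d c t : J → ℕ) (p : ℕ × ℕ) (i : ℕ) : Prop :=
  ∀ j, p.1 ≤ d j → c j ≤ p.2 → i + 1 < t j

open Classical in
/-- Replaces each variable by the sum of its layered copies. -/
noncomputable def layerSum (K : Type*) [Field K] (V : Set (ℕ × ℕ)) (d c t : J → ℕ) (N : ℕ) :
    MvPolynomial V K →ₐ[K] MvPolynomial (V × ℕ) K :=
  aeval fun p => ∑ i ∈ Finset.range N, if LayerAllowed d c t p i then X (p, i) else 0

/-- Replaces each layered variable by a product of a row and a column variable. -/
noncomputable def rowMulCol (K : Type*) [Field K] (V : Set (ℕ × ℕ)) :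
    MvPolynomial (V × ℕ) K →ₐ[K] MvPolynomial ((ℕ × ℕ) ⊕ (ℕ × ℕ)) K :=
  aeval fun z => X (Sum.inl (z.2, z.1.1.1)) * X (Sum.inr (z.2, z.1.1.2))

theorem rowMulCol_monomial (ρ : V × ℕ →₀ ℕ) (x : K) :
    rowMulCol K V (monomial ρ x) = monomial (layeredContent ρ) x := by
  rw [rowMulCol, aeval_monomial, layeredContent, Finsupp.weight_apply, Finsupp.prod, Finsupp.sum,
    ← mul_one x, ← C_mul_monomial, monomial_sum_one, mul_one]
  congr 1
  refine Finset.prod_congr rfl fun z _ => ?_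
  rw [X, X, monomial_mul, monomial_pow, one_mul, one_pow]

theorem rowMulCol_layerSum_eq_zero [LinearOrder J] (hd : Monotone d) (hc : Monotone c)
    (ht : ∀ j, 1 ≤ t j) {N : ℕ} (hN : ∀ j, t j ≤ N) {f : MvPolynomial V K}
    (hf : f ∈ mixedIdeal K V d c t) : rowMulCol K V (layerSum K V d c t N f) = 0 := by
  classical
  suffices h : mixedIdeal K V d c t ≤
      RingHom.ker ((rowMulCol K V).comp (layerSum K V d c t N)) from h hf
  refine iSup_le fun j => Ideal.span_le.mpr ?_
  rintro _ ⟨r, cc, -, -, hmem, hV, rfl⟩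
  let A : Matrix (Fin (t j)) (Fin (t j)) (MvPolynomial ((ℕ × ℕ) ⊕ (ℕ × ℕ)) K) :=
    Matrix.of fun a i => if (i : ℕ) + 1 < t j ∧ ∀ j' ≤ j, r a ≤ d j' → (i : ℕ) + 1 < t j'
      then X (Sum.inl ((i : ℕ), r a)) else 0
  let B : Matrix (Fin (t j)) (Fin (t j)) (MvPolynomial ((ℕ × ℕ) ⊕ (ℕ × ℕ)) K) :=
    Matrix.of fun i b => if ∀ j', j ≤ j' → c j' ≤ cc b → (i : ℕ) + 1 < t j'
      then X (Sum.inr ((i : ℕ), cc b)) else 0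
  have hA : A.det = 0 := by
    have : t j - 1 < t j := Nat.sub_lt (ht j) one_pos
    refine Matrix.det_eq_zero_of_column_eq_zero ⟨t j - 1, this⟩ fun a => if_neg fun h => ?_
    have := h.1
    simp only at this
    omega
  rw [SetLike.mem_coe, RingHom.mem_ker, AlgHom.map_det]
  have hAB : (((rowMulCol K V).comp (layerSum K V d c t N)).mapMatrix
      (Matrix.of fun a b => X (⟨(r a, cc b), hV a b⟩ : V))) = A * B := by
    refine Matrix.ext fun a b => ?_
    rw [Matrix.mul_apply]
    have hab := (hmem a b).2
    simp only [AlgHom.mapMatrix_apply, Matrix.map_apply, Matrix.of_apply, AlgHom.comp_apply,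
      layerSum, aeval_X, map_sum, A, B]
    rw [Fin.sum_univ_eq_sum_range (fun i => (if i + 1 < t j ∧ ∀ j' ≤ j, r a ≤ d j' → i + 1 < t j'
      then X (Sum.inl (i, r a)) else 0) * (if ∀ j', j ≤ j' → c j' ≤ cc b → i + 1 < t j'
      then X (Sum.inr (i, cc b)) else 0) : ℕ → MvPolynomial ((ℕ × ℕ) ⊕ (ℕ × ℕ)) K) (t j)]
    rw [← Finset.sum_subset (Finset.range_mono (hN j))]
    on_goal 2 =>
      intro i _ hi
      have h : ¬ LayerAllowed d c t (r a, cc b) i := fun h => by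
        have := h j hab.1 hab.2
        exact hi (Finset.mem_range.mpr (by omega))
      rw [if_neg h, map_zero]
    · refine Finset.sum_congr rfl fun i _ => ?_
      have hiff : LayerAllowed d c t (r a, cc b) i ↔
          (i + 1 < t j ∧ ∀ j' ≤ j, r a ≤ d j' → i + 1 < t j') ∧
            ∀ j', j ≤ j' → c j' ≤ cc b → i + 1 < t j' := by
        refine ⟨fun h => ⟨⟨h j hab.1 hab.2, fun j' hj h1 => h j' h1 ((hc hj).trans hab.2)⟩,
          fun j' hj h1 => h j' (hab.1.trans (hd hj)) h1⟩, fun h j' h1 h2 => ?_⟩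
        rcases le_total j' j with hj | hj
        · exact h.1.2 j' hj h1
        · exact h.2 j' hj h2
      rw [apply_ite (rowMulCol K V), map_zero, if_congr hiff rfl rfl, ite_and, ite_zero_mul_ite_zero,
        ← ite_and]
      simp [rowMulCol]
  rw [hAB, Matrix.det_mul, hA, zero_mul]

theorem forgetLayers_of_mem_support {N : ℕ} {f : MvPolynomial V K} {ρ : V × ℕ →₀ ℕ}
    (hρ : ρ ∈ (layerSum K V d c t N f).support) : forgetLayers ρ ∈ f.support := by
  classical
  rw [f.as_sum, map_sum] at hρ
  obtain ⟨τ, hτ, hρτ⟩ := Finset.mem_biUnion.mp (support_sum hρ)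
  suffices h : IsWeightedHomogeneous (fun z : V × ℕ => Finsupp.single z.1 1)
      (layerSum K V d c t N (monomial τ (coeff τ f))) τ by
    rwa [show forgetLayers ρ = τ from h (mem_support_iff.mp hρτ)]
  rw [layerSum, aeval_monomial, algebraMap_eq]
  refine IsWeightedHomogeneous.C_mul ?_ _
  suffices h : IsWeightedHomogeneous (fun z : V × ℕ => Finsupp.single z.1 1)
      (τ.prod fun p n => (∑ i ∈ Finset.range N, if LayerAllowed d c t p i
        then (X (p, i) : MvPolynomial (V × ℕ) K) else 0) ^ n) (τ.sum Finsupp.single) by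
    rwa [τ.sum_single] at h
  refine IsWeightedHomogeneous.prod _ _ _ fun p _ => ?_
  rw [← Finsupp.smul_single_one]
  refine IsWeightedHomogeneous.pow (IsWeightedHomogeneous.sum _ _ _ fun i _ => ?_) _
  split_ifs
  · exact isWeightedHomogeneous_X K _ _
  · exact isWeightedHomogeneous_zero K _ _

theorem layerAllowed_layer {σ τ : V →₀ ℕ} (hσ : IsStandard d c t σ)
    (hτ : IsStandard d c t τ) {p : ℕ × ℕ} (hp : p ∈ positions τ) :
    LayerAllowed d c t p (layer (positions σ) p) := by
  intro j h1 h2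
  by_cases h : p ∈ positions σ
  · exact layer_succ_lt h fun h' => hσ j (h'.mono fun q hq =>
      ⟨hq.1, hq.2.1.trans h1, h2.trans hq.2.2⟩)
  · rw [layer_of_notMem h]
    by_contra! hle
    refine hτ j (HasAntidiagonal.of_le (n := 1) ⟨fun _ => p.1, fun _ => p.2,
      Subsingleton.strictMono _, Subsingleton.strictAnti _, fun _ => ⟨hp, h1, h2⟩⟩ (by omega))

theorem eq_zero_of_standard [LinearOrder J] (hd : Monotone d) (hc : Monotone c)
    (ht : ∀ j, 1 ≤ t j) {N : ℕ} (hN : ∀ j, t j ≤ N) (hcov : ∀ p ∈ V, ∃ j, p.1 ≤ d j ∧ c j ≤ p.2)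
    {f : MvPolynomial V K} (hf : f ∈ mixedIdeal K V d c t)
    (hstd : ∀ σ ∈ f.support, IsStandard d c t σ) : f = 0 := by
  classical
  by_contra hne
  obtain ⟨σ, hσ⟩ := f.support.exists_minimalFor southEastCount
    (Finset.nonempty_iff_ne_empty.mpr (mt support_eq_empty.mp hne))
  let e : V → V × ℕ := fun p => (p, layer (positions σ) p)
  have he : Function.Injective e := fun p q h => congrArg Prod.fst h
  have hkill : killCompl he (layerSum K V d c t N f) = f := by
    conv_lhs => rw [f.as_sum]
    conv_rhs => rw [f.as_sum]
    rw [map_sum, map_sum]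
    refine Finset.sum_congr rfl fun τ hτ => ?_
    rw [layerSum, aeval_monomial, map_mul, monomial_eq, algebraMap_eq, killCompl_C, Finsupp.prod,
      map_prod, Finsupp.prod]
    congr 1
    refine Finset.prod_congr rfl fun p hp => ?_
    have hall := layerAllowed_layer (hstd σ hσ.1) (hstd τ hτ) (p := p)
      ⟨p.2, Finsupp.mem_support_iff.mp hp⟩
    have hlt : layer (positions σ) p ∈ Finset.range N := by
      obtain ⟨j, h1, h2⟩ := hcov p p.2
      have := hall j h1 h2
      have := hN j
      exact Finset.mem_range.mpr (by omega)
    rw [map_pow, map_sum, Finset.sum_eq_single_of_mem _ hlt]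
    · rw [if_pos hall, show ((p, layer (positions σ) p) : V × ℕ) = e p from rfl, ← rename_X,
        killCompl_rename_app]
    · intro i _ hi
      split_ifs
      · rw [X, killCompl_monomial_eq_zero_of_notMem_range he _ (a := (p, i)) (by simp)]
        rintro ⟨q, hq⟩
        obtain rfl : q = p := congrArg Prod.fst hq
        exact hi (congrArg Prod.snd hq).symm
      · exact map_zero _
  have hmem : σ.mapDomain e ∈ (layerSum K V d c t N f).support := by
    have h := mem_support_iff.mp hσ.1
    conv at h => rw [← hkill, (layerSum K V d c t N f).as_sum, map_sum, coeff_sum]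
    obtain ⟨ρ, hρ, hne⟩ := Finset.exists_ne_zero_of_sum_ne_zero h
    by_cases hsub : (ρ.support : Set (V × ℕ)) ⊆ Set.range e
    · rw [killCompl_monomial_eq_monomial_comapDomain_of_subset he _ hsub, coeff_monomial] at hne
      have : ρ.comapDomain e he.injOn = σ := by
        by_contra h
        exact hne (if_neg h)
      rwa [← this, Finsupp.mapDomain_comapDomain _ he _ hsub]
    · rw [killCompl_monomial_eq_zero_of_not_subset he _ hsub, coeff_zero] at hne
      exact absurd rfl hne
  have hchain : IsLayeredChain (σ.mapDomain e) := by
    intro z hz z' hz' heq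
    obtain ⟨p, hp, rfl⟩ := Finset.mem_image.mp (Finsupp.mapDomain_support hz)
    obtain ⟨q, hq, rfl⟩ := Finset.mem_image.mp (Finsupp.mapDomain_support hz')
    rintro ⟨h1, h2⟩
    have hp' : (p : ℕ × ℕ) ∈ positions σ := ⟨p.2, Finsupp.mem_support_iff.mp hp⟩
    have hq' : (q : ℕ × ℕ) ∈ positions σ := ⟨q.2, Finsupp.mem_support_iff.mp hq⟩
    exact (layer_lt_layer hp' hq' h1 h2).ne heq.symm
  have hforget : forgetLayers (σ.mapDomain e) = σ := by
    rw [forgetLayers, Finsupp.weight_apply, Finsupp.sum_mapDomain_index (by simp)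
      (by intros; rw [add_smul])]
    simp [e]
  have hzero := rowMulCol_layerSum_eq_zero hd hc ht hN hf
  rw [(layerSum K V d c t N f).as_sum, map_sum] at hzero
  simp only [rowMulCol_monomial] at hzero
  have hcoeff := congrArg (coeff (layeredContent (σ.mapDomain e))) hzero
  rw [coeff_sum, Finset.sum_eq_single_of_mem _ hmem, coeff_monomial, if_pos rfl, coeff_zero]
    at hcoeff
  · exact mem_support_iff.mp hmem hcoeff
  · intro ρ hρ hne
    rw [coeff_monomial, if_neg]
    refine fun h => hne (hchain.eq_of_content_eq h fun hle => ?_)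
    rw [hforget] at hle ⊢
    exact hσ.2 (forgetLayers_of_mem_support hρ) hle

theorem linearIndependent_standard [LinearOrder J] (hd : Monotone d) (hc : Monotone c)
    (ht : ∀ j, 1 ≤ t j) {N : ℕ} (hN : ∀ j, t j ≤ N)
    (hcov : ∀ p ∈ V, ∃ j, p.1 ≤ d j ∧ c j ≤ p.2) :
    LinearIndependent K fun σ : {σ : V →₀ ℕ | IsStandard d c t σ} =>
      Ideal.Quotient.mk (mixedIdeal K V d c t) (monomial σ.1 1) := by
  classical
  rw [linearIndependent_iff']
  intro s g hg σ hσ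
  have hmk : Ideal.Quotient.mk (mixedIdeal K V d c t)
      (∑ τ ∈ s, monomial τ.1 (g τ)) = 0 := by
    rw [map_sum, ← hg]
    refine Finset.sum_congr rfl fun τ _ => ?_
    rw [← Ideal.Quotient.mkₐ_eq_mk K, ← map_smul, smul_monomial, smul_eq_mul, mul_one]
  have hcoeff : ∀ τ, coeff τ (∑ τ ∈ s, monomial τ.1 (g τ)) =
      ∑ τ' ∈ s, if τ'.1 = τ then g τ' else 0 := by
    intro τ
    simp only [coeff_sum, coeff_monomial]
  have h0 := eq_zero_of_standard hd hc ht hN hcov (Ideal.Quotient.eq_zero_iff_mem.mp hmk) (by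
    intro τ hτ
    rw [mem_support_iff, hcoeff] at hτ
    obtain ⟨τ', -, h⟩ := Finset.exists_ne_zero_of_sum_ne_zero hτ
    rw [ite_ne_right_iff] at h
    exact h.1 ▸ τ'.2)
  have := hcoeff σ.1
  rw [h0, coeff_zero, Finset.sum_eq_single_of_mem σ hσ, if_pos rfl] at this
  · exact this.symm
  · exact fun τ _ hne => if_neg fun h => hne (Subtype.ext h)

end Independence

section TensorProduct

open TensorProduct

variable {K : Type*} [Field K]

theorem isRegular_and_height_of_free {Z T : Type*} [Fintype Z] [CommRing T] [Nontrivial T]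
    [IsNoetherianRing T] [Algebra (MvPolynomial Z K) T] [Module.Free (MvPolynomial Z K) T]
    {θ : Z → T} (hθ : ∀ z, algebraMap (MvPolynomial Z K) T (X z) = θ z) :
    Function.Injective θ ∧ RingTheory.Sequence.IsRegular T (Finset.univ.toList.map θ) ∧
      (Ideal.span (Set.range θ)).height = Fintype.card Z := by
  obtain rfl : (fun z => algebraMap (MvPolynomial Z K) T (X z)) = θ := funext hθ
  refine ⟨?_, ?_, height_span_of_faithfullyFlat⟩
  · exact (FaithfulSMul.algebraMap_injective (MvPolynomial Z K) T).comp (X_injective)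
  · have := RingTheory.Sequence.IsRegular.of_faithfullyFlat (S := T)
      (isRegular_map_X (K := K) (Finset.nodup_toList (Finset.univ : Finset Z)))
    rwa [List.map_map] at this

theorem exists_list_of_isRegular {Z T : Type*} [Fintype Z] [CommRing T] {θ : Z → T} {s : Set T}
    (hinj : Function.Injective θ)
    (hreg : RingTheory.Sequence.IsRegular T (Finset.univ.toList.map θ))
    (hheight : (Ideal.span (Set.range θ)).height = Fintype.card Z) (hs : Set.range θ = s) :
    idealHeight (Ideal.span s) = (Fintype.card Z : ℕ∞) ∧ ∃ l : List T, l.Nodup ∧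
      (∀ f, f ∈ l ↔ f ∈ s) ∧ l.length = Fintype.card Z ∧ RingTheory.Sequence.IsRegular T l := by
  subst hs
  refine ⟨(idealHeight_eq_height _).trans hheight, _, (Finset.nodup_toList _).map hinj,
    fun f => ?_, ?_, hreg⟩
  · simp
  · simp

variable {A B V W : Type*} [CommRing A] [Algebra K A] [CommRing B] [Algebra K B]

/-- The presentation of a tensor product of two presented algebras. -/
noncomputable def tensorPresentation (πA : MvPolynomial V K →ₐ[K] A)
    (πB : MvPolynomial W K →ₐ[K] B) : MvPolynomial (V ⊕ W) K →ₐ[K] A ⊗[K] B :=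
  aeval (Sum.elim (fun v => πA (X v) ⊗ₜ[K] 1) fun v => 1 ⊗ₜ[K] πB (X v))

theorem tensorPresentation_monomial (πA : MvPolynomial V K →ₐ[K] A)
    (πB : MvPolynomial W K →ₐ[K] B) (σ : V →₀ ℕ) (τ : W →₀ ℕ) :
    tensorPresentation πA πB (monomial (σ.sumElim τ) 1) =
      πA (monomial σ 1) ⊗ₜ[K] πB (monomial τ 1) := by
  have hA : (πA (monomial σ 1) ⊗ₜ[K] 1 : A ⊗[K] B) =
      σ.prod fun v n => (πA (X v) ⊗ₜ[K] 1 : A ⊗[K] B) ^ n := by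
    have := map_finsuppProd ((Algebra.TensorProduct.includeLeft : A →ₐ[K] A ⊗[K] B).comp πA) σ
      fun v n => X v ^ n
    rw [monomial_eq, C_1, one_mul]
    simpa using this
  have hB : (1 ⊗ₜ[K] πB (monomial τ 1) : A ⊗[K] B) =
      τ.prod fun v n => (1 ⊗ₜ[K] πB (X v) : A ⊗[K] B) ^ n := by
    have := map_finsuppProd ((Algebra.TensorProduct.includeRight : B →ₐ[K] A ⊗[K] B).comp πB) τ
      fun v n => X v ^ n
    rw [monomial_eq, C_1, one_mul]
    simpa using this
  rw [tensorPresentation, aeval_monomial, map_one, one_mul, Finsupp.prod_sumElim]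
  calc _ = (πA (monomial σ 1) ⊗ₜ[K] 1 : A ⊗[K] B) * 1 ⊗ₜ[K] πB (monomial τ 1) := by
        rw [hA, hB]; rfl
    _ = _ := by rw [Algebra.TensorProduct.tmul_mul_tmul, one_mul, mul_one]

theorem tensorPresentation_X_inl (πA : MvPolynomial V K →ₐ[K] A)
    (πB : MvPolynomial W K →ₐ[K] B) (v : V) :
    tensorPresentation πA πB (X (Sum.inl v)) = πA (X v) ⊗ₜ[K] 1 :=
  aeval_X _ _

theorem tensorPresentation_X_inr (πA : MvPolynomial V K →ₐ[K] A)
    (πB : MvPolynomial W K →ₐ[K] B) (v : W) :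
    tensorPresentation πA πB (X (Sum.inr v)) = 1 ⊗ₜ[K] πB (X v) :=
  aeval_X _ _

theorem tensorPresentation_surjective {πA : MvPolynomial V K →ₐ[K] A}
    {πB : MvPolynomial W K →ₐ[K] B} (hA : Function.Surjective πA) (hB : Function.Surjective πB) :
    Function.Surjective (tensorPresentation πA πB) := by
  have h1 : (tensorPresentation πA πB).comp (rename Sum.inl) =
      Algebra.TensorProduct.includeLeft.comp πA :=
    algHom_ext fun v => by simp [tensorPresentation_X_inl]
  have h2 : (tensorPresentation πA πB).comp (rename Sum.inr) =
      Algebra.TensorProduct.includeRight.comp πB :=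
    algHom_ext fun v => by simp [tensorPresentation_X_inr]
  rw [← AlgHom.range_eq_top, eq_top_iff]
  rintro x -
  induction x using TensorProduct.induction_on with
  | zero => exact zero_mem _
  | add x y hx hy => exact add_mem hx hy
  | tmul a b =>
    obtain ⟨f, rfl⟩ := hA a
    obtain ⟨g, rfl⟩ := hB b
    refine ⟨rename Sum.inl f * rename Sum.inr g, ?_⟩
    have h1' := DFunLike.congr_fun h1 f
    have h2' := DFunLike.congr_fun h2 g
    simp only [AlgHom.comp_apply, Algebra.TensorProduct.includeLeft_apply,
      Algebra.TensorProduct.includeRight_apply] at h1' h2'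
    simp [h1', h2']

theorem free_tensorProduct {Z : Type*} [Algebra (MvPolynomial Z K) (A ⊗[K] B)]
    [IsScalarTower K (MvPolynomial Z K) (A ⊗[K] B)]
    {πA : MvPolynomial V K →ₐ[K] A} {πB : MvPolynomial W K →ₐ[K] B}
    (hA : Function.Surjective πA) (hB : Function.Surjective πB)
    {SA : Set (V →₀ ℕ)} {SB : Set (W →₀ ℕ)} (hSA : IsLowerSet SA) (hSB : IsLowerSet SB)
    {wA : V → ℕ} {wB : W → ℕ}
    (hliA : LinearIndependent K (fun σ : SA => πA (monomial σ.1 1)))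
    (hliB : LinearIndependent K (fun σ : SB => πB (monomial σ.1 1)))
    (hspA : ∀ σ, πA (monomial σ 1) ∈ Submodule.span K ((fun τ => πA (monomial τ 1)) ''
      {τ | τ ∈ SA ∧ Finsupp.weight wA τ ≤ Finsupp.weight wA σ}))
    (hspB : ∀ σ, πB (monomial σ 1) ∈ Submodule.span K ((fun τ => πB (monomial τ 1)) ''
      {τ | τ ∈ SB ∧ Finsupp.weight wB τ ≤ Finsupp.weight wB σ}))
    {f : Z → V} {g : Z → W} (hf : Function.Injective f) (hg : Function.Injective g)
    (P : Z → Prop)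
    (hP : ∀ z, P z → wB (g z) < wA (f z) ∧ ∀ σ ∈ SA, ∀ n, σ + Finsupp.single (f z) n ∈ SA)
    (hnP : ∀ z, ¬ P z → wA (f z) < wB (g z) ∧ ∀ σ ∈ SB, ∀ n, σ + Finsupp.single (g z) n ∈ SB)
    (hθ : ∀ z, algebraMap (MvPolynomial Z K) (A ⊗[K] B) (X z) =
      πA (X (f z)) ⊗ₜ[K] 1 - 1 ⊗ₜ[K] πB (X (g z))) :
    Module.Free (MvPolynomial Z K) (A ⊗[K] B) := by
  classical
  let l : (V ⊕ W →₀ ℕ) → (V →₀ ℕ) := fun σ => σ.comapDomain Sum.inl Sum.inl_injective.injOn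
  let r : (V ⊕ W →₀ ℕ) → (W →₀ ℕ) := fun σ => σ.comapDomain Sum.inr Sum.inr_injective.injOn
  have hlr : ∀ σ, (l σ).sumElim (r σ) = σ := Finsupp.comapDomain_sumElim_comapDomain
  have hmon : ∀ σ, tensorPresentation πA πB (monomial σ 1) =
      πA (monomial (l σ) 1) ⊗ₜ[K] πB (monomial (r σ) 1) := fun σ => by
    rw [← tensorPresentation_monomial, hlr]
  have hweight : ∀ σ, Finsupp.weight (Sum.elim wA wB) σ =
      Finsupp.weight wA (l σ) + Finsupp.weight wB (r σ) := fun σ => by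
    conv_lhs => rw [← hlr σ, Finsupp.sumElim_eq_add, map_add]
    simp only [Finsupp.weight_apply]
    rw [Finsupp.sum_mapDomain_index_inj Sum.inl_injective,
      Finsupp.sum_mapDomain_index_inj Sum.inr_injective]
    rfl
  refine free_of_standard_monomials (tensorPresentation πA πB) (tensorPresentation_surjective hA hB)
    {σ | l σ ∈ SA ∧ r σ ∈ SB} (Sum.elim wA wB) ?_ ?_
    (fun z => if P z then Sum.inl (f z) else Sum.inr (g z))
    (fun z => if P z then Sum.inr (g z) else Sum.inl (f z)) ?_ ?_ ?_ ?_
    (fun z => if P z then 1 else -1) ?_ ?_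
  · have h := hliA.tmul_of_flat_left hliB
    let e : {σ : V ⊕ W →₀ ℕ | l σ ∈ SA ∧ r σ ∈ SB} → SA × SB :=
      fun σ => (⟨l σ.1, σ.2.1⟩, ⟨r σ.1, σ.2.2⟩)
    have he : Function.Injective e := by
      intro σ τ h
      have h1 : l σ.1 = l τ.1 := congrArg (fun x => x.1.1) h
      have h2 : r σ.1 = r τ.1 := congrArg (fun x => x.2.1) h
      exact Subtype.ext (by rw [← hlr σ.1, ← hlr τ.1, h1, h2])
    simp only [hmon]
    exact h.comp e he
  · intro σ
    have h := Submodule.apply_mem_map₂ (TensorProduct.mk K A B) (hspA (l σ)) (hspB (r σ))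
    rw [Submodule.map₂_span_span] at h
    rw [hmon]
    refine Submodule.span_mono ?_ h
    rintro _ ⟨_, ⟨τ, ⟨hτ, hwτ⟩, rfl⟩, _, ⟨τ', ⟨hτ', hwτ'⟩, rfl⟩, rfl⟩
    have hl : l (τ.sumElim τ') = τ := Finsupp.comapDomain_inl_sumElim _ _
    have hr : r (τ.sumElim τ') = τ' := Finsupp.comapDomain_inr_sumElim _ _
    refine ⟨τ.sumElim τ', ⟨⟨hl.symm ▸ hτ, hr.symm ▸ hτ'⟩, ?_⟩, tensorPresentation_monomial _ _ _ _⟩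
    rw [hweight, hweight, hl, hr]
    exact add_le_add hwτ hwτ'
  · intro z z' h
    simp only at h
    split_ifs at h
    · exact hf (Sum.inl_injective h)
    · exact hg (Sum.inr_injective h)
  · intro z
    by_cases h : P z
    · simpa [h] using (hP z h).1
    · simpa [h] using (hnP z h).1
  · intro σ hσ α
    induction α using Finsupp.induction_linear generalizing σ with
    | zero => simpa using hσ
    | add α β hα hβ =>
      rw [Finsupp.mapDomain_add, ← add_assoc]
      exact hβ _ (hα _ hσ)
    | single z n =>
      have hadd : ∀ τ, l (σ + τ) = l σ + l τ ∧ r (σ + τ) = r σ + r τ := fun τ =>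
        ⟨by ext; rfl, by ext; rfl⟩
      have hl : ∀ v, l (Finsupp.single (Sum.inl v) n) = Finsupp.single v n ∧
          r (Finsupp.single (Sum.inl v) n) = 0 := fun v =>
        ⟨by rw [← Finsupp.sumElim_single_zero]; exact Finsupp.comapDomain_inl_sumElim _ _,
          by rw [← Finsupp.sumElim_single_zero]; exact Finsupp.comapDomain_inr_sumElim _ _⟩
      have hr : ∀ v, l (Finsupp.single (Sum.inr v) n) = 0 ∧
          r (Finsupp.single (Sum.inr v) n) = Finsupp.single v n := fun v =>
        ⟨by rw [← Finsupp.sumElim_zero_single]; exact Finsupp.comapDomain_inl_sumElim _ _,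
          by rw [← Finsupp.sumElim_zero_single]; exact Finsupp.comapDomain_inr_sumElim _ _⟩
      rw [Finsupp.mapDomain_single]
      refine ⟨?_, ?_⟩
      · rw [(hadd _).1]
        split_ifs with h
        · rw [(hl _).1]
          exact (hP z h).2 _ hσ.1 n
        · rw [(hr _).1, add_zero]
          exact hσ.1
      · rw [(hadd _).2]
        split_ifs with h
        · rw [(hl _).2, add_zero]
          exact hσ.2
        · rw [(hr _).2]
          exact (hnP z h).2 _ hσ.2 n
  · intro σ τ hle hσ
    exact ⟨hSA (fun v => hle (Sum.inl v)) hσ.1, hSB (fun v => hle (Sum.inr v)) hσ.2⟩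
  · intro z
    by_cases h : P z <;> simp [h]
  · intro z
    rw [hθ]
    by_cases h : P z <;> simp [h, tensorPresentation_X_inl, tensorPresentation_X_inr]

theorem isRegular_and_height_tensorProduct {Z : Type*} [Fintype Z] [Finite V] [Finite W]
    {πA : MvPolynomial V K →ₐ[K] A} {πB : MvPolynomial W K →ₐ[K] B}
    (hA : Function.Surjective πA) (hB : Function.Surjective πB)
    {SA : Set (V →₀ ℕ)} {SB : Set (W →₀ ℕ)} (hSA : IsLowerSet SA) (hSB : IsLowerSet SB)
    (hzA : 0 ∈ SA) (hzB : 0 ∈ SB) {wA : V → ℕ} {wB : W → ℕ}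
    (hliA : LinearIndependent K (fun σ : SA => πA (monomial σ.1 1)))
    (hliB : LinearIndependent K (fun σ : SB => πB (monomial σ.1 1)))
    (hspA : ∀ σ, πA (monomial σ 1) ∈ Submodule.span K ((fun τ => πA (monomial τ 1)) ''
      {τ | τ ∈ SA ∧ Finsupp.weight wA τ ≤ Finsupp.weight wA σ}))
    (hspB : ∀ σ, πB (monomial σ 1) ∈ Submodule.span K ((fun τ => πB (monomial τ 1)) ''
      {τ | τ ∈ SB ∧ Finsupp.weight wB τ ≤ Finsupp.weight wB σ}))
    {f : Z → V} {g : Z → W} (hf : Function.Injective f) (hg : Function.Injective g)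
    (P : Z → Prop)
    (hP : ∀ z, P z → wB (g z) < wA (f z) ∧ ∀ σ ∈ SA, ∀ n, σ + Finsupp.single (f z) n ∈ SA)
    (hnP : ∀ z, ¬ P z → wA (f z) < wB (g z) ∧ ∀ σ ∈ SB, ∀ n, σ + Finsupp.single (g z) n ∈ SB)
    {θ : Z → A ⊗[K] B} (hθ : ∀ z, θ z = πA (X (f z)) ⊗ₜ[K] 1 - 1 ⊗ₜ[K] πB (X (g z))) :
    Function.Injective θ ∧ RingTheory.Sequence.IsRegular (A ⊗[K] B) (Finset.univ.toList.map θ) ∧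
      (Ideal.span (Set.range θ)).height = Fintype.card Z := by
  have : Nontrivial (A ⊗[K] B) :=
    ⟨_, 0, (hliA.tmul_of_flat_left hliB).ne_zero (⟨0, hzA⟩, ⟨0, hzB⟩)⟩
  have : IsNoetherianRing (A ⊗[K] B) :=
    isNoetherianRing_of_surjective _ _ (tensorPresentation πA πB).toRingHom
      (tensorPresentation_surjective hA hB)
  let : Algebra (MvPolynomial Z K) (A ⊗[K] B) := (aeval θ).toRingHom.toAlgebra
  have : IsScalarTower K (MvPolynomial Z K) (A ⊗[K] B) :=
    IsScalarTower.of_algebraMap_eq fun x => ((aeval θ).commutes x).symm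
  have hX : ∀ z, algebraMap (MvPolynomial Z K) (A ⊗[K] B) (X z) = θ z := aeval_X θ
  have := free_tensorProduct hA hB hSA hSB hliA hliB hspA hspB hf hg P hP hnP
    fun z => (hX z).trans (hθ z)
  exact isRegular_and_height_of_free hX

end TensorProduct

section Gluing

open TensorProduct

theorem map_rename_minorsIdeal_le (K : Type*) [Field K] {V W S S' : Set (ℕ × ℕ)} (hVW : V ⊆ W)
    (hS : S ⊆ S') (n : ℕ) :
    (minorsIdeal K V S n).map (rename (R := K) (Set.inclusion hVW)) ≤ minorsIdeal K W S' n := by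
  rw [minorsIdeal, Ideal.map_span, Ideal.span_le]
  rintro _ ⟨_, ⟨r, cc, hr, hcc, hmem, hV, rfl⟩, rfl⟩
  refine Ideal.subset_span ⟨r, cc, hr, hcc, fun a b => hS (hmem a b), fun a b => hVW (hV a b), ?_⟩
  rw [AlgHom.map_det]
  congr 1
  refine Matrix.ext fun a b => ?_
  simp [Set.inclusion]

theorem minorsIdeal_le_map_rename (K : Type*) [Field K] {V W S S' : Set (ℕ × ℕ)} (hVW : V ⊆ W)
    (hSV : S ⊆ V) {n : ℕ} (h : ∀ r cc : Fin n → ℕ, StrictMono r → StrictMono cc →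
      (∀ a b, (r a, cc b) ∈ S') → ∀ a b, (r a, cc b) ∈ S) :
    minorsIdeal K W S' n ≤ (minorsIdeal K V S n).map (rename (R := K) (Set.inclusion hVW)) := by
  rw [minorsIdeal, minorsIdeal, Ideal.map_span, Ideal.span_le]
  rintro _ ⟨r, cc, hr, hcc, hmem, hW, rfl⟩
  have hS := h r cc hr hcc hmem
  refine Ideal.subset_span ⟨_, ⟨r, cc, hr, hcc, hS, fun a b => hSV (hS a b), rfl⟩, ?_⟩
  rw [AlgHom.map_det]
  congr 1
  refine Matrix.ext fun a b => ?_
  simp [Set.inclusion]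

theorem exists_surjective_ker_eq_span {K α A₁ A₂ : Type*} [Field K] [CommRing A₁] [Algebra K A₁]
    [CommRing A₂] [Algebra K A₂] {V V₁ V₂ : Set α} (h₁ : V₁ ⊆ V) (h₂ : V₂ ⊆ V) (hV : V ⊆ V₁ ∪ V₂)
    {π₁ : MvPolynomial V₁ K →ₐ[K] A₁} {π₂ : MvPolynomial V₂ K →ₐ[K] A₂}
    (hπ₁ : Function.Surjective π₁) (hπ₂ : Function.Surjective π₂) {I : Ideal (MvPolynomial V K)}
    (hI : I = (RingHom.ker π₁).map (rename (R := K) (Set.inclusion h₁)) ⊔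
      (RingHom.ker π₂).map (rename (R := K) (Set.inclusion h₂)))
    {φ₁ : A₁ →ₐ[K] MvPolynomial V K ⧸ I} {φ₂ : A₂ →ₐ[K] MvPolynomial V K ⧸ I}
    (hφ₁ : ∀ p, φ₁ (π₁ (X p)) = Ideal.Quotient.mk I (X (Set.inclusion h₁ p)))
    (hφ₂ : ∀ p, φ₂ (π₂ (X p)) = Ideal.Quotient.mk I (X (Set.inclusion h₂ p))) :
    ∃ φ : A₁ ⊗[K] A₂ →ₐ[K] MvPolynomial V K ⧸ I,
      Function.Surjective φ ∧ RingHom.ker φ = Ideal.span {f | ∃ (p : α) (h1 : p ∈ V₁) (h2 : p ∈ V₂),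
        f = π₁ (X ⟨p, h1⟩) ⊗ₜ[K] 1 - 1 ⊗ₜ[K] π₂ (X ⟨p, h2⟩)} := by
  classical
  set G := Ideal.span {f : A₁ ⊗[K] A₂ | ∃ (p : α) (h1 : p ∈ V₁) (h2 : p ∈ V₂),
    f = π₁ (X ⟨p, h1⟩) ⊗ₜ[K] 1 - 1 ⊗ₜ[K] π₂ (X ⟨p, h2⟩)} with hG
  let φ := Algebra.TensorProduct.productMap φ₁ φ₂
  have hφl : ∀ x, φ (x ⊗ₜ 1) = φ₁ x := fun x => Algebra.TensorProduct.productMap_left_apply _ _ x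
  have hφr : ∀ x, φ (1 ⊗ₜ x) = φ₂ x := fun x => Algebra.TensorProduct.productMap_right_apply _ _ x
  let ψ : MvPolynomial V K →ₐ[K] (A₁ ⊗[K] A₂) ⧸ G :=
    aeval fun p : V => if h : (p : α) ∈ V₁
      then Ideal.Quotient.mk G (π₁ (X ⟨p, h⟩) ⊗ₜ[K] 1)
      else Ideal.Quotient.mk G (1 ⊗ₜ[K] π₂ (X ⟨p, (hV p.2).resolve_left h⟩))
  have hψ₁ : ψ.comp (rename (Set.inclusion h₁)) = (Ideal.Quotient.mkₐ K G).comp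
      (Algebra.TensorProduct.includeLeft.comp π₁) := by
    refine algHom_ext fun p => ?_
    rw [AlgHom.comp_apply, rename_X, aeval_X, dif_pos p.2]
    rfl
  have hψ₂ : ψ.comp (rename (Set.inclusion h₂)) = (Ideal.Quotient.mkₐ K G).comp
      (Algebra.TensorProduct.includeRight.comp π₂) := by
    refine algHom_ext fun p => ?_
    rw [AlgHom.comp_apply, rename_X, aeval_X]
    split_ifs with h
    · exact Ideal.Quotient.eq.mpr (Ideal.subset_span ⟨p, h, p.2, rfl⟩)
    · rfl
  have hψ : ∀ f ∈ I, ψ f = 0 := by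
    suffices h : I ≤ RingHom.ker ψ from fun f hf => h hf
    rw [hI, sup_le_iff, Ideal.map_le_iff_le_comap, Ideal.map_le_iff_le_comap]
    refine ⟨fun f hf => ?_, fun f hf => ?_⟩
    · have := DFunLike.congr_fun hψ₁ f
      rw [AlgHom.comp_apply, AlgHom.comp_apply, AlgHom.comp_apply, RingHom.mem_ker.mp hf, map_zero,
        map_zero] at this
      exact this
    · have := DFunLike.congr_fun hψ₂ f
      rw [AlgHom.comp_apply, AlgHom.comp_apply, AlgHom.comp_apply, RingHom.mem_ker.mp hf, map_zero,
        map_zero] at this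
      exact this
  let ψ' := Ideal.Quotient.liftₐ I ψ hψ
  have hcomp : ψ'.comp φ = Ideal.Quotient.mkₐ K G := by
    refine Algebra.TensorProduct.ext ?_ ?_
    · refine (AlgHom.cancel_right hπ₁).mp (algHom_ext fun p => ?_)
      have := DFunLike.congr_fun hψ₁ (X p)
      rw [AlgHom.comp_apply, rename_X] at this
      exact (congrArg ψ' ((hφl _).trans (hφ₁ p))).trans this
    · refine (AlgHom.cancel_right hπ₂).mp (algHom_ext fun p => ?_)
      have := DFunLike.congr_fun hψ₂ (X p)
      rw [AlgHom.comp_apply, rename_X] at this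
      exact (congrArg ψ' ((hφr _).trans (hφ₂ p))).trans this
  refine ⟨φ, ?_, le_antisymm (fun x hx => ?_) (Ideal.span_le.mpr ?_)⟩
  · intro y
    obtain ⟨f, rfl⟩ := Ideal.Quotient.mk_surjective y
    have hrange : ((Ideal.Quotient.mkₐ K I).range) ≤ φ.range := by
      rw [← Algebra.map_top, ← adjoin_range_X, AlgHom.map_adjoin, Algebra.adjoin_le_iff]
      rintro _ ⟨_, ⟨p, rfl⟩, rfl⟩
      rcases hV p.2 with h | h
      · exact ⟨_, (hφl _).trans (hφ₁ ⟨p, h⟩)⟩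
      · exact ⟨_, (hφr _).trans (hφ₂ ⟨p, h⟩)⟩
    exact hrange ⟨f, rfl⟩
  · have := DFunLike.congr_fun hcomp x
    rw [AlgHom.comp_apply, (RingHom.mem_ker).mp hx, map_zero] at this
    exact Ideal.Quotient.eq_zero_iff_mem.mp this.symm
  · rintro _ ⟨p, h1, h2, rfl⟩
    rw [SetLike.mem_coe, RingHom.mem_ker, map_sub, hφl, hφr, hφ₁, hφ₂]
    exact sub_self _

end Gluing

section StandardVariables

variable {V : Set (ℕ × ℕ)} {J : Type*} {d c t : J → ℕ}

theorem isStandard_zero (ht : ∀ j, 1 ≤ t j) : IsStandard d c t (0 : V →₀ ℕ) := by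
  rintro j ⟨r, cc, -, -, h⟩
  obtain ⟨⟨_, h0⟩, -⟩ := h ⟨0, ht j⟩
  exact h0 rfl

theorem IsStandard.add_single {σ : V →₀ ℕ} (hσ : IsStandard d c t σ) {p : V}
    (hp : ∀ j, ∀ r cc : Fin (t j) → ℕ, StrictMono r → StrictAnti cc →
      (∀ a, (r a, cc a) ∈ V ∧ r a ≤ d j ∧ c j ≤ cc a) → ∀ a, (r a, cc a) ≠ (p : ℕ × ℕ)) (n : ℕ) :
    IsStandard d c t (σ + Finsupp.single p n) := by
  rintro j ⟨r, cc, hr, hcc, h⟩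
  refine hσ j ⟨r, cc, hr, hcc, fun a => ?_⟩
  obtain ⟨⟨hV, hne⟩, hreg⟩ := h a
  refine ⟨⟨hV, ?_⟩, hreg⟩
  have : (⟨(r a, cc a), hV⟩ : V) ≠ p := fun h' =>
    hp j r cc hr hcc (fun b => ⟨(h b).1.1, (h b).2⟩) a (congrArg Subtype.val h')
  rwa [Finsupp.add_apply, Finsupp.single_eq_of_ne this, add_zero] at hne

theorem StrictMono.add_sub_le {n : ℕ} {r : Fin n → ℕ} (hr : StrictMono r) {a b : Fin n}
    (hab : a ≤ b) : r a + (b - a : ℕ) ≤ r b := by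
  obtain ⟨b, hb⟩ := b
  obtain ⟨i, rfl⟩ := Nat.exists_eq_add_of_le (show (a : ℕ) ≤ b from hab)
  induction i with
  | zero => simp
  | succ i ih =>
    have h1 := ih (by omega) (Fin.le_def.mpr (Nat.le_add_right _ _))
    have h2 := hr (show (⟨a + i, by omega⟩ : Fin n) < ⟨a + (i + 1), hb⟩ from
      Fin.lt_def.mpr (by simp))
    simp only at h1 h2 ⊢
    omega

theorem StrictAnti.add_sub_le {n : ℕ} {r : Fin n → ℕ} (hr : StrictAnti r) {a b : Fin n}
    (hab : a ≤ b) : r b + (b - a : ℕ) ≤ r a := by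
  have h := (hr.comp Fin.rev_strictAnti).add_sub_le (Fin.rev_le_rev.mpr hab)
  simp only [Function.comp_apply, Fin.rev_rev, Fin.val_rev] at h
  omega

end StandardVariables

namespace LadderData

variable (D : LadderData)

/-- The ladder spanned by the upper outside corners in `I` and the lower outside corners in `J`. -/
def subladder (I : Set (Fin D.h)) (J : Set (Fin D.k)) : Set (ℕ × ℕ) :=
  {p | (∃ i ∈ I, D.b i ≤ p.1 ∧ p.2 ≤ D.a i) ∧ ∃ j ∈ J, p.1 ≤ D.d j ∧ D.c j ≤ p.2}

variable {D}

theorem one_le_b (i : Fin D.h) : 1 ≤ D.b i :=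
  D.b_first ▸ D.b_mono.monotone (Fin.le_def.mpr (Nat.zero_le _))

theorem one_le_c (j : Fin D.k) : 1 ≤ D.c j :=
  D.c_first ▸ D.c_mono (Fin.le_def.mpr (Nat.zero_le _))

theorem a_le (i : Fin D.h) : D.a i ≤ D.n :=
  D.a_last ▸ D.a_mono.monotone (Fin.le_def.mpr (Nat.le_sub_one_of_lt i.2))

theorem d_le (j : Fin D.k) : D.d j ≤ D.m :=
  D.d_last ▸ D.d_mono (Fin.le_def.mpr (Nat.le_sub_one_of_lt j.2))

theorem d_add_t_le {j j' : Fin D.k} (h : j ≤ j') : D.d j + D.t j' ≤ D.d j' + D.t j := by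
  obtain ⟨b, hb⟩ := j'
  obtain ⟨i, rfl⟩ := Nat.exists_eq_add_of_le (show (j : ℕ) ≤ b from h)
  induction i with
  | zero => simp
  | succ i ih =>
    have h1 := ih (by omega) (Fin.le_def.mpr (Nat.le_add_right _ _))
    have h2 := D.step_d (j + i) hb
    simp only [← Nat.add_assoc] at h1 h2 ⊢
    omega

theorem c_add_t_le {j j' : Fin D.k} (h : j ≤ j') : D.c j + D.t j ≤ D.c j' + D.t j' := by
  obtain ⟨b, hb⟩ := j'
  obtain ⟨i, rfl⟩ := Nat.exists_eq_add_of_le (show (j : ℕ) ≤ b from h)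
  induction i with
  | zero => simp
  | succ i ih =>
    have h1 := ih (by omega) (Fin.le_def.mpr (Nat.le_add_right _ _))
    have h2 := D.step_c (j + i) hb
    simp only [← Nat.add_assoc] at h1 h2 ⊢
    omega

theorem isLadder_subladder (I : Set (Fin D.h)) (J : Set (Fin D.k)) :
    IsLadder (D.subladder I J) := by
  rintro p ⟨⟨i, hi, hb, ha⟩, -⟩ q ⟨-, j, hj, hd, hc⟩ x y h1 h2 h3 h4
  exact ⟨⟨i, hi, hb.trans h1, h4.trans ha⟩, j, hj, h2.trans hd, hc.trans h3⟩

theorem subladder_mono {I I' : Set (Fin D.h)} {J J' : Set (Fin D.k)} (hI : I ⊆ I') (hJ : J ⊆ J') :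
    D.subladder I J ⊆ D.subladder I' J' := fun _ ⟨⟨i, hi, h⟩, j, hj, h'⟩ =>
  ⟨⟨i, hI hi, h⟩, j, hJ hj, h'⟩

theorem finite_subladder (I : Set (Fin D.h)) (J : Set (Fin D.k)) : (D.subladder I J).Finite :=
  ((Set.finite_Iic D.m).prod (Set.finite_Iic D.n)).subset fun _ ⟨⟨i, _, _, ha⟩, j, _, hd, _⟩ =>
    ⟨hd.trans (d_le j), ha.trans (a_le i)⟩

theorem L_eq_subladder : D.L = D.subladder Set.univ Set.univ := by
  ext p
  constructor
  · rintro ⟨i, j, h1, -, -, h4, -, h6, h7, -⟩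
    exact ⟨⟨i, trivial, h1, h4⟩, j, trivial, h6, h7⟩
  · rintro ⟨⟨i, -, h1, h4⟩, j, -, h6, h7⟩
    exact ⟨i, j, h1, h6.trans (d_le j), (one_le_c j).trans h7, h4, (one_le_b i).trans h1, h6, h7,
      h4.trans (a_le i)⟩

theorem subladder_subset_L (I : Set (Fin D.h)) (J : Set (Fin D.k)) : D.subladder I J ⊆ D.L :=
  L_eq_subladder ▸ subladder_mono (Set.subset_univ _) (Set.subset_univ _)

variable {i₀ i₁ : Fin D.h} {j₀ j₁ : Fin D.k}

theorem mem_subladder_Iic_of_minor (hi : ∀ i, i₀ < i → i₁ ≤ i)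
    (hbd : D.d j₀ + 2 ≤ D.b i₁ + D.t j₀) {j : Fin D.k} (hj : j ≤ j₀) {r cc : Fin (D.t j) → ℕ}
    (hr : StrictMono r) (hmem : ∀ u v, (r u, cc v) ∈ D.Lj j) (u v : Fin (D.t j)) :
    (r u, cc v) ∈ D.subladder (Set.Iic i₀) (Set.Iic j₀) := by
  refine ⟨?_, j, hj, (hmem u v).2⟩
  have hfirst := hmem ⟨0, u.pos⟩ v
  have hlast := hmem ⟨D.t j - 1, Nat.sub_one_lt_of_lt u.pos⟩ v
  obtain ⟨⟨i, _, hb, -, -, ha, -⟩, -⟩ := hfirst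
  simp only at hb ha
  refine ⟨i, ?_, hb.trans (hr.monotone (Fin.le_def.mpr (Nat.zero_le _))), ha⟩
  by_contra hlt
  have h1 := D.b_mono.monotone (hi i (not_le.mp hlt))
  have h2 := hr.add_sub_le (a := ⟨0, u.pos⟩) (b := ⟨D.t j - 1, Nat.sub_one_lt_of_lt u.pos⟩)
    (Fin.le_def.mpr (Nat.zero_le _))
  have h3 := d_add_t_le hj
  have h4 := hlast.2.1
  have h5 := D.t_pos j
  simp only at h2 h4
  omega

theorem mem_subladder_Ioi_of_minor (hj₁ : ∀ j, j₀ < j → j₁ ≤ j)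
    (hac : D.a i₀ + 2 ≤ D.c j₁ + D.t j₁) {j : Fin D.k} (hj : j₀ < j) {r cc : Fin (D.t j) → ℕ}
    (hcc : StrictMono cc) (hmem : ∀ u v, (r u, cc v) ∈ D.Lj j) (u v : Fin (D.t j)) :
    (r u, cc v) ∈ D.subladder (Set.Ioi i₀) (Set.Ioi j₀) := by
  refine ⟨?_, j, hj, (hmem u v).2⟩
  have hfirst := hmem u ⟨0, u.pos⟩
  have hlast := hmem u ⟨D.t j - 1, Nat.sub_one_lt_of_lt u.pos⟩
  obtain ⟨⟨i, _, hb, -, -, ha, -⟩, -⟩ := hlast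
  simp only at hb ha
  refine ⟨i, ?_, hb, (hcc.monotone (Fin.le_def.mpr (Nat.le_sub_one_of_lt v.2))).trans ha⟩
  by_contra hlt
  have h1 := D.a_mono.monotone (not_lt.mp hlt)
  have h2 := hcc.add_sub_le (a := ⟨0, u.pos⟩) (b := ⟨D.t j - 1, Nat.sub_one_lt_of_lt u.pos⟩)
    (Fin.le_def.mpr (Nat.zero_le _))
  have h3 := c_add_t_le (hj₁ j hj)
  have h4 := hfirst.2.2
  have h5 := D.t_pos j
  simp only at h2 h4
  omega

theorem L_subset_union (hnd : D.Nondeg) (hi : ∀ i, i₀ < i → i₁ ≤ i) (hj₁ : ∀ j, j₀ < j → j₁ ≤ j)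
    (hbd : D.d j₀ + 2 ≤ D.b i₁ + D.t j₀) (hac : D.a i₀ + 2 ≤ D.c j₁ + D.t j₁) :
    D.L ⊆ D.subladder (Set.Iic i₀) (Set.Iic j₀) ∪ D.subladder (Set.Ioi i₀) (Set.Ioi j₀) := by
  intro p hp
  obtain ⟨j, r, cc, hr, hcc, hmem, u, v, rfl⟩ := hnd p hp
  rcases le_or_gt j j₀ with hj | hj
  · exact Or.inl (mem_subladder_Iic_of_minor hi hbd hj hr hmem u v)
  · exact Or.inr (mem_subladder_Ioi_of_minor hj₁ hac hj hcc hmem u v)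

theorem It_eq_sup_map (K : Type*) [Field K] (hi : ∀ i, i₀ < i → i₁ ≤ i)
    (hj₁ : ∀ j, j₀ < j → j₁ ≤ j) (hbd : D.d j₀ + 2 ≤ D.b i₁ + D.t j₀)
    (hac : D.a i₀ + 2 ≤ D.c j₁ + D.t j₁) :
    D.It K =
      (mixedIdeal K (D.subladder (Set.Iic i₀) (Set.Iic j₀)) (fun j : {j // j ≤ j₀} => D.d j)
        (fun j => D.c j) fun j => D.t j).map
          (rename (R := K) (Set.inclusion (subladder_subset_L (Set.Iic i₀) (Set.Iic j₀)))) ⊔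
      (mixedIdeal K (D.subladder (Set.Ioi i₀) (Set.Ioi j₀)) (fun j : {j // j₀ < j} => D.d j)
        (fun j => D.c j) fun j => D.t j).map
          (rename (R := K) (Set.inclusion (subladder_subset_L (Set.Ioi i₀) (Set.Ioi j₀)))) := by
  rw [mixedIdeal, mixedIdeal, Ideal.map_iSup, Ideal.map_iSup, It]
  refine le_antisymm (iSup_le fun j => ?_) (sup_le (iSup_le fun j => ?_) (iSup_le fun j => ?_))
  · rcases le_or_gt j j₀ with hj | hj
    · exact le_sup_of_le_left (le_iSup_of_le ⟨j, hj⟩ (minorsIdeal_le_map_rename K _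
        (Set.sep_subset _ _) fun r cc hr _ hmem u v =>
          ⟨mem_subladder_Iic_of_minor hi hbd hj hr hmem u v, (hmem u v).2⟩))
    · exact le_sup_of_le_right (le_iSup_of_le ⟨j, hj⟩ (minorsIdeal_le_map_rename K _
        (Set.sep_subset _ _) fun r cc _ hcc hmem u v =>
          ⟨mem_subladder_Ioi_of_minor hj₁ hac hj hcc hmem u v, (hmem u v).2⟩))
  · refine le_iSup_of_le j.1 (map_rename_minorsIdeal_le K _ ?_ _)
    exact fun p hp => ⟨subladder_subset_L _ _ hp.1, hp.2⟩
  · refine le_iSup_of_le j.1 (map_rename_minorsIdeal_le K _ ?_ _)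
    exact fun p hp => ⟨subladder_subset_L _ _ hp.1, hp.2⟩

theorem mem_subladder_inter_iff (hi : ∀ i, i₀ < i ↔ i₁ ≤ i) (hj₁ : ∀ j, j₀ < j ↔ j₁ ≤ j)
    {p : ℕ × ℕ} :
    p ∈ D.subladder (Set.Iic i₀) (Set.Iic j₀) ∧ p ∈ D.subladder (Set.Ioi i₀) (Set.Ioi j₀) ↔
      (D.b i₁ ≤ p.1 ∧ p.1 ≤ D.d j₀) ∧ D.c j₁ ≤ p.2 ∧ p.2 ≤ D.a i₀ := by
  have hii : i₀ < i₁ := (hi i₁).mpr le_rfl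
  have hjj : j₀ < j₁ := (hj₁ j₁).mpr le_rfl
  constructor
  · rintro ⟨⟨⟨i, hi', -, ha⟩, j, hj', hd, -⟩, ⟨i', hi'', hb, -⟩, j', hj'', -, hc⟩
    exact ⟨⟨(D.b_mono.monotone ((hi i').mp hi'')).trans hb, hd.trans (D.d_mono hj')⟩,
      (D.c_mono ((hj₁ j').mp hj'')).trans hc, ha.trans (D.a_mono.monotone hi')⟩
  · rintro ⟨⟨hb, hd⟩, hc, ha⟩
    exact ⟨⟨⟨i₀, Set.self_mem_Iic, (D.b_mono hii).le.trans hb, ha⟩, j₀, Set.self_mem_Iic, hd,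
      (D.c_mono hjj.le).trans hc⟩, ⟨i₁, hii, hb, ha.trans (D.a_mono hii).le⟩, j₁, hjj,
      hd.trans (D.d_mono hjj.le), hc⟩

theorem add_le_of_antidiagonal_Iic {J : Set (Fin D.k)} {j : Fin D.k} (hj : j ≤ j₀)
    {r cc : Fin (D.t j) → ℕ} (hr : StrictMono r) (hcc : StrictAnti cc)
    (hmem : ∀ u, (r u, cc u) ∈ D.subladder (Set.Iic i₀) J ∧ r u ≤ D.d j ∧ D.c j ≤ cc u)
    (u : Fin (D.t j)) : r u + cc u + D.t j₀ ≤ D.d j₀ + D.a i₀ + 1 := by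
  have h1 := hr.add_sub_le (b := ⟨D.t j - 1, Nat.sub_one_lt_of_lt u.pos⟩)
    (Fin.le_def.mpr (Nat.le_sub_one_of_lt u.2))
  have h2 := hcc.add_sub_le (a := ⟨0, u.pos⟩) (Fin.le_def.mpr (Nat.zero_le u))
  have h3 := (hmem ⟨D.t j - 1, Nat.sub_one_lt_of_lt u.pos⟩).2.1
  obtain ⟨⟨i, hi, -, h4⟩, -⟩ := (hmem ⟨0, u.pos⟩).1
  have h5 := D.a_mono.monotone hi
  have h6 := d_add_t_le hj
  have h7 := u.2
  simp only at h1 h2 h3 h4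
  omega

theorem le_add_of_antidiagonal_Ioi {J : Set (Fin D.k)} (hi : ∀ i, i₀ < i → i₁ ≤ i) {j : Fin D.k}
    (hj : j₁ ≤ j) {r cc : Fin (D.t j) → ℕ} (hr : StrictMono r) (hcc : StrictAnti cc)
    (hmem : ∀ u, (r u, cc u) ∈ D.subladder (Set.Ioi i₀) J ∧ r u ≤ D.d j ∧ D.c j ≤ cc u)
    (u : Fin (D.t j)) : D.b i₁ + D.c j₁ + D.t j₁ ≤ r u + cc u + 1 := by
  have h1 := hcc.add_sub_le (b := ⟨D.t j - 1, Nat.sub_one_lt_of_lt u.pos⟩)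
    (Fin.le_def.mpr (Nat.le_sub_one_of_lt u.2))
  have h2 := hr.add_sub_le (a := ⟨0, u.pos⟩) (Fin.le_def.mpr (Nat.zero_le u))
  have h3 := (hmem ⟨D.t j - 1, Nat.sub_one_lt_of_lt u.pos⟩).2.2
  obtain ⟨⟨i, hi', h4, -⟩, -⟩ := (hmem ⟨0, u.pos⟩).1
  have h5 := D.b_mono.monotone (hi i hi')
  have h6 := c_add_t_le hj
  have h7 := u.2
  simp only at h1 h2 h3 h4
  omega

end LadderData

section DiagonalWeights

/-- A diagonal weight, which decreases along the straightening of antidiagonals. -/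
def diagonalWeight (p : ℕ × ℕ) : ℕ := ((p.1 : ℤ) - p.2).natAbs ^ 2

theorem diagonalWeight_cast (u v : ℕ) :
    (diagonalWeight (u, v) : ℤ) = (u : ℤ) ^ 2 + (v : ℤ) ^ 2 - 2 * (u * v) := by
  rw [diagonalWeight, Nat.cast_pow, Int.natCast_natAbs, sq_abs]
  ring

variable {K : Type*} [Field K] {V : Set (ℕ × ℕ)} {J : Type*} {d c t : J → ℕ}

theorem monomial_mem_span_standard_sum (hV : IsLadder V) (σ : V →₀ ℕ) :
    Ideal.Quotient.mk (mixedIdeal K V d c t) (monomial σ 1) ∈ Submodule.span K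
      ((fun τ => Ideal.Quotient.mk (mixedIdeal K V d c t) (monomial τ (1 : K))) ''
        {τ | IsStandard d c t τ ∧
          Finsupp.weight (fun p : V => diagonalWeight p + 2 * (p.1.1 + p.1.2)) τ ≤
            Finsupp.weight (fun p : V => diagonalWeight p + 2 * (p.1.1 + p.1.2)) σ}) :=
  monomial_mem_span_standard hV (w := fun p => diagonalWeight p + 2 * (p.1 + p.2))
    (f := fun u => (u : ℤ) ^ 2 + 2 * u) (g := fun v => (v : ℤ) ^ 2 + 2 * v)
    (fun u v => by push_cast [diagonalWeight_cast]; ring) σ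

theorem monomial_mem_span_standard_const (hV : IsLadder V) (s : ℕ) (σ : V →₀ ℕ) :
    Ideal.Quotient.mk (mixedIdeal K V d c t) (monomial σ 1) ∈ Submodule.span K
      ((fun τ => Ideal.Quotient.mk (mixedIdeal K V d c t) (monomial τ (1 : K))) ''
        {τ | IsStandard d c t τ ∧
          Finsupp.weight (fun p : V => diagonalWeight p + (2 * s + 1)) τ ≤
            Finsupp.weight (fun p : V => diagonalWeight p + (2 * s + 1)) σ}) :=
  monomial_mem_span_standard hV (w := fun p => diagonalWeight p + (2 * s + 1))
    (f := fun u => (u : ℤ) ^ 2 + (2 * s + 1)) (g := fun v => (v : ℤ) ^ 2)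
    (fun u v => by push_cast [diagonalWeight_cast]; ring) σ

end DiagonalWeights

open TensorProduct in
set_option synthInstance.maxHeartbeats 1000000 in
set_option maxHeartbeats 1000000 in
/-- **Remark (splitting along overlapping corners).** Suppose that for some `i, j` one has
`b_{i+1} ≥ d_j − t_j + 2` and `a_i ≤ c_{j+1} + t_{j+1} − 2`.  Let `L_1` be the ladder with
lower outside corners `(d_1,c_1),…,(d_j,c_j)` and upper outside corners `(b_1,a_1),…,(b_i,a_i)`
(inside the matrix `X_1` with rows `1,…,d_j` and columns `1,…,a_i`), and let `L_2` be the
ladder with lower outside corners `(d_{j+1},c_{j+1}),…,(d_k,c_k)` and upper outside corners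
`(b_{i+1},a_{i+1}),…,(b_h,a_h)` (inside `X_2`, with variables disjoint from those of `X_1`).
With `σ = (t_1,…,t_j)`, `τ = (t_{j+1},…,t_k)`, `R_σ(L_1) = K[L_1]/I_σ(L_1)` and
`R_τ(L_2) = K[L_2]/I_τ(L_2)` one has `R_t(L) ≅ (R_σ(L_1) ⊗_K R_τ(L_2))/I`, where `I` is
generated by the `(d_j − b_{i+1} + 1)(a_i − c_{j+1} + 1)` linear forms `x_{v,u} − y_{v,u}`
(`b_{i+1} ≤ v ≤ d_j`, `c_{j+1} ≤ u ≤ a_i`); moreover `ht I = (d_j − b_{i+1} + 1)(a_i − c_{j+1} + 1)`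
and these linear forms form a regular sequence in `R_σ(L_1) ⊗_K R_τ(L_2)`. -/
theorem mixedLadderDeterminantal_split_tensor (K : Type*) [Field K]
    (D : LadderData) (hnd : D.Nondeg)
    (i0 : Fin D.h) (j0 : Fin D.k) (hi1 : (i0 : ℕ) + 1 < D.h) (hj1 : (j0 : ℕ) + 1 < D.k)
    (hbd : ((D.b ⟨(i0 : ℕ) + 1, hi1⟩ : ℤ)) ≥ (D.d j0 : ℤ) - (D.t j0 : ℤ) + 2)
    (hac : ((D.a i0 : ℤ)) ≤ (D.c ⟨(j0 : ℕ) + 1, hj1⟩ : ℤ) + (D.t ⟨(j0 : ℕ) + 1, hj1⟩ : ℤ) - 2)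
    (L1 L2 : Set (ℕ × ℕ))
    (hL1 : L1 = {p | ∃ (i' : Fin D.h) (j' : Fin D.k), i' ≤ i0 ∧ j' ≤ j0 ∧
      D.b i' ≤ p.1 ∧ p.1 ≤ D.d j0 ∧ 1 ≤ p.2 ∧ p.2 ≤ D.a i' ∧
      1 ≤ p.1 ∧ p.1 ≤ D.d j' ∧ D.c j' ≤ p.2 ∧ p.2 ≤ D.a i0})
    (hL2 : L2 = {p | ∃ (i' : Fin D.h) (j' : Fin D.k), i0 < i' ∧ j0 < j' ∧
      D.b i' ≤ p.1 ∧ p.1 ≤ D.m ∧ D.c ⟨(j0 : ℕ) + 1, hj1⟩ ≤ p.2 ∧ p.2 ≤ D.a i' ∧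
      D.b ⟨(i0 : ℕ) + 1, hi1⟩ ≤ p.1 ∧ p.1 ≤ D.d j' ∧ D.c j' ≤ p.2 ∧ p.2 ≤ D.n})
    (Iσ : Ideal (MvPolynomial ↥L1 K))
    (hIσ : Iσ = ⨆ j' : {j' : Fin D.k // j' ≤ j0},
      minorsIdeal K L1 {p ∈ L1 | p.1 ≤ D.d j'.1 ∧ D.c j'.1 ≤ p.2} (D.t j'.1))
    (Iτ : Ideal (MvPolynomial ↥L2 K))
    (hIτ : Iτ = ⨆ j' : {j' : Fin D.k // j0 < j'},
      minorsIdeal K L2 {p ∈ L2 | p.1 ≤ D.d j'.1 ∧ D.c j'.1 ≤ p.2} (D.t j'.1))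
    (gens : Set ((MvPolynomial ↥L1 K ⧸ Iσ) ⊗[K] (MvPolynomial ↥L2 K ⧸ Iτ)))
    (hgens : gens = {f | ∃ v u : ℕ,
      D.b ⟨(i0 : ℕ) + 1, hi1⟩ ≤ v ∧ v ≤ D.d j0 ∧
      D.c ⟨(j0 : ℕ) + 1, hj1⟩ ≤ u ∧ u ≤ D.a i0 ∧
      ∃ (h1 : (v, u) ∈ L1) (h2 : (v, u) ∈ L2),
      f = (Ideal.Quotient.mk Iσ (MvPolynomial.X (⟨(v, u), h1⟩ : L1))) ⊗ₜ[K] 1 -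
          1 ⊗ₜ[K] (Ideal.Quotient.mk Iτ (MvPolynomial.X (⟨(v, u), h2⟩ : L2)))}) :
    (∃ φ : ((MvPolynomial ↥L1 K ⧸ Iσ) ⊗[K] (MvPolynomial ↥L2 K ⧸ Iτ)) →ₐ[K]
        (MvPolynomial ↥D.L K ⧸ D.It K),
      Function.Surjective φ ∧ RingHom.ker φ = Ideal.span gens) ∧
    idealHeight (Ideal.span gens) =
      (((D.d j0 + 1 - D.b ⟨(i0 : ℕ) + 1, hi1⟩) *
        (D.a i0 + 1 - D.c ⟨(j0 : ℕ) + 1, hj1⟩) : ℕ) : ℕ∞) ∧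
    ∃ lst : List ((MvPolynomial ↥L1 K ⧸ Iσ) ⊗[K] (MvPolynomial ↥L2 K ⧸ Iτ)),
      lst.Nodup ∧ (∀ f, f ∈ lst ↔ f ∈ gens) ∧
      lst.length = (D.d j0 + 1 - D.b ⟨(i0 : ℕ) + 1, hi1⟩) *
        (D.a i0 + 1 - D.c ⟨(j0 : ℕ) + 1, hj1⟩) ∧
      RingTheory.Sequence.IsRegular
        ((MvPolynomial ↥L1 K ⧸ Iσ) ⊗[K] (MvPolynomial ↥L2 K ⧸ Iτ)) lst := by
  have hi : ∀ i, i0 < i ↔ ⟨(i0 : ℕ) + 1, hi1⟩ ≤ i := fun i => Iff.rfl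
  have hj : ∀ j, j0 < j ↔ ⟨(j0 : ℕ) + 1, hj1⟩ ≤ j := fun j => Iff.rfl
  generalize (⟨(i0 : ℕ) + 1, hi1⟩ : Fin D.h) = i₁ at *
  generalize (⟨(j0 : ℕ) + 1, hj1⟩ : Fin D.k) = j₁ at *
  replace hbd : D.d j0 + 2 ≤ D.b i₁ + D.t j0 := by omega
  replace hac : D.a i0 + 2 ≤ D.c j₁ + D.t j₁ := by omega
  obtain rfl : L1 = D.subladder (Set.Iic i0) (Set.Iic j0) := by
    rw [hL1]
    ext p
    constructor
    · rintro ⟨i, j, hi', hj', h1, -, -, h4, -, h6, h7, -⟩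
      exact ⟨⟨i, hi', h1, h4⟩, j, hj', h6, h7⟩
    · rintro ⟨⟨i, hi', h1, h4⟩, j, hj', h6, h7⟩
      exact ⟨i, j, hi', hj', h1, h6.trans (D.d_mono hj'), (LadderData.one_le_c j).trans h7, h4,
        (LadderData.one_le_b i).trans h1, h6, h7, h4.trans (D.a_mono.monotone hi')⟩
  obtain rfl : L2 = D.subladder (Set.Ioi i0) (Set.Ioi j0) := by
    rw [hL2]
    ext p
    constructor
    · rintro ⟨i, j, hi', hj', h1, -, -, h4, -, h6, h7, -⟩
      exact ⟨⟨i, hi', h1, h4⟩, j, hj', h6, h7⟩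
    · rintro ⟨⟨i, hi', h1, h4⟩, j, hj', h6, h7⟩
      exact ⟨i, j, hi', hj', h1, h6.trans (LadderData.d_le j),
        (D.c_mono ((hj j).mp hj')).trans h7, h4,
        (D.b_mono.monotone ((hi i).mp hi')).trans h1, h6, h7, h4.trans (LadderData.a_le i)⟩
  clear hL1 hL2
  obtain rfl : Iσ = mixedIdeal K _ (fun j : {j // j ≤ j0} => D.d j) (fun j => D.c j)
    fun j => D.t j := hIσ
  obtain rfl : Iτ = mixedIdeal K _ (fun j : {j // j0 < j} => D.d j) (fun j => D.c j)
    fun j => D.t j := hIτ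
  have hmemZ := fun p : ℕ × ℕ => LadderData.mem_subladder_inter_iff (p := p) hi hj
  let Z := Finset.Icc (D.b i₁) (D.d j0) ×ˢ Finset.Icc (D.c j₁) (D.a i0)
  have hZ : ∀ p : Z, (p : ℕ × ℕ) ∈ D.subladder (Set.Iic i0) (Set.Iic j0) ∧
      (p : ℕ × ℕ) ∈ D.subladder (Set.Ioi i0) (Set.Ioi j0) := fun p => by
    rw [hmemZ, ← Finset.mem_Icc, ← Finset.mem_Icc, ← Finset.mem_product]
    exact p.2
  have hcard : Fintype.card Z = (D.d j0 + 1 - D.b i₁) * (D.a i0 + 1 - D.c j₁) := by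
    rw [Fintype.card_coe, Finset.card_product, Nat.card_Icc, Nat.card_Icc]
  obtain rfl : gens = {f | ∃ (p : ℕ × ℕ) (h1 : p ∈ D.subladder (Set.Iic i0) (Set.Iic j0))
      (h2 : p ∈ D.subladder (Set.Ioi i0) (Set.Ioi j0)),
      f = (Ideal.Quotient.mk _ (X ⟨p, h1⟩)) ⊗ₜ[K] 1 -
          1 ⊗ₜ[K] (Ideal.Quotient.mk _ (X ⟨p, h2⟩))} := by
    rw [hgens]
    ext f
    constructor
    · rintro ⟨v, u, -, -, -, -, h1, h2, rfl⟩
      exact ⟨(v, u), h1, h2, rfl⟩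
    · rintro ⟨p, h1, h2, rfl⟩
      obtain ⟨⟨hb, hd⟩, hc, ha⟩ := (hmemZ p).mp ⟨h1, h2⟩
      exact ⟨p.1, p.2, hb, hd, hc, ha, h1, h2, rfl⟩
  clear hgens
  have hI := LadderData.It_eq_sup_map (D := D) K (fun i => (hi i).mp) (fun j => (hj j).mp) hbd hac
  have hlift {V : Set (ℕ × ℕ)} (hV : V ⊆ D.L) {I : Ideal (MvPolynomial V K)}
      (hle : I.map (rename (R := K) (Set.inclusion hV)) ≤ D.It K) :
      ∃ φ : (MvPolynomial V K ⧸ I) →ₐ[K] MvPolynomial D.L K ⧸ D.It K,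
        ∀ p, φ (Ideal.Quotient.mk I (X p)) = Ideal.Quotient.mk _ (X (Set.inclusion hV p)) :=
    ⟨Ideal.Quotient.liftₐ I ((Ideal.Quotient.mkₐ K _).comp (rename (Set.inclusion hV)))
      fun f hf => Ideal.Quotient.eq_zero_iff_mem.mpr (hle (Ideal.mem_map_of_mem _ hf)),
      fun p => congrArg (Ideal.Quotient.mk _) (rename_X _ _)⟩
  have hker {V : Set (ℕ × ℕ)} (I : Ideal (MvPolynomial V K)) :
      RingHom.ker (Ideal.Quotient.mkₐ K I) = I := Ideal.ext fun _ => Ideal.Quotient.eq_zero_iff_mem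
  refine ⟨?_, ?_⟩
  · obtain ⟨φ₁, hφ₁⟩ := hlift _ (le_sup_left.trans hI.ge)
    obtain ⟨φ₂, hφ₂⟩ := hlift _ (le_sup_right.trans hI.ge)
    exact exists_surjective_ker_eq_span _ _
      (LadderData.L_subset_union hnd (fun i => (hi i).mp) (fun j => (hj j).mp) hbd hac)
      (Ideal.Quotient.mkₐ_surjective K _) (Ideal.Quotient.mkₐ_surjective K _)
      (by rw [hker, hker]; exact hI) hφ₁ hφ₂
  have := (D.finite_subladder (Set.Iic i0) (Set.Iic j0)).to_subtype
  have := (D.finite_subladder (Set.Ioi i0) (Set.Ioi j0)).to_subtype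
  set s := D.d j0 + D.a i0 + 1 - D.t j0 with hs
  have hN : ∀ j, D.t j ≤ Finset.univ.sup D.t := fun j => Finset.le_sup (Finset.mem_univ j)
  obtain ⟨hinj, hreg, hheight⟩ := isRegular_and_height_tensorProduct (Z := Z)
    (Ideal.Quotient.mkₐ_surjective K _) (Ideal.Quotient.mkₐ_surjective K _)
    (isLowerSet_isStandard _ _ _) (isLowerSet_isStandard _ _ _)
    (isStandard_zero fun j : {j // j ≤ j0} => D.t_pos j)
    (isStandard_zero fun j : {j // j0 < j} => D.t_pos j)
    (linearIndependent_standard (K := K) (V := D.subladder (Set.Iic i0) (Set.Iic j0))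
      (J := {j // j ≤ j0}) (d := fun j => D.d j) (c := fun j => D.c j) (t := fun j => D.t j)
      (fun _ _ h => D.d_mono h) (fun _ _ h => D.c_mono h)
      (fun j => D.t_pos j) (fun j => hN j) fun p hp => let ⟨_, j, h, h'⟩ := hp; ⟨⟨j, h⟩, h'⟩)
    (linearIndependent_standard (K := K) (V := D.subladder (Set.Ioi i0) (Set.Ioi j0))
      (J := {j // j0 < j}) (d := fun j => D.d j) (c := fun j => D.c j) (t := fun j => D.t j)
      (fun _ _ h => D.d_mono h) (fun _ _ h => D.c_mono h)
      (fun j => D.t_pos j) (fun j => hN j) fun p hp => let ⟨_, j, h, h'⟩ := hp; ⟨⟨j, h⟩, h'⟩)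
    (monomial_mem_span_standard_sum (LadderData.isLadder_subladder _ _))
    (monomial_mem_span_standard_const (LadderData.isLadder_subladder _ _) s)
    (f := fun z => ⟨z, (hZ z).1⟩) (g := fun z => ⟨z, (hZ z).2⟩)
    (fun _ _ h => Subtype.ext (Subtype.mk.inj h)) (fun _ _ h => Subtype.ext (Subtype.mk.inj h))
    (fun z => s < z.1.1 + z.1.2)
    (fun z hz => ⟨by dsimp only; omega, fun σ hσ n => hσ.add_single
      (fun j r cc hr hcc hmem u hu => by
        have h := LadderData.add_le_of_antidiagonal_Iic j.2 hr hcc hmem u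
        rw [Prod.ext_iff] at hu
        simp only at hu
        omega) n⟩)
    (fun z hz => ⟨by dsimp only; omega, fun σ hσ n => hσ.add_single
      (fun j r cc hr hcc hmem u hu => by
        have h := LadderData.le_add_of_antidiagonal_Ioi (fun i => (hi i).mp) ((hj j).mp j.2)
          hr hcc hmem u
        have h' := LadderData.one_le_b i₁
        have h'' := ((hmemZ z).mp (hZ z)).1.1
        rw [Prod.ext_iff] at hu
        simp only at hu
        omega) n⟩)
    (fun z => rfl)
  rw [← hcard]
  refine exists_list_of_isRegular hinj hreg hheight (Set.ext fun f => ⟨?_, ?_⟩)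
  · rintro ⟨z, rfl⟩
    exact ⟨z, (hZ z).1, (hZ z).2, rfl⟩
  · rintro ⟨p, h1, h2, rfl⟩
    have hp := (hmemZ p).mp ⟨h1, h2⟩
    exact ⟨⟨p, Finset.mem_product.mpr
      ⟨Finset.mem_Icc.mpr hp.1, Finset.mem_Icc.mpr hp.2⟩⟩, rfl⟩
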